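/- If v > 0 and max_{k∈V} ‖Y_k − c_k‖_∞ ≤ L for some L ∈ (0,∞), then, with ρ := |E[(S − E[S])³]|, d_K(W, N(0,1)) ≤ 0.607148·ρ/v³ + 116.84·(D+1)³·𝒜₄/v⁴ + max{ 16.57·L(D+1)/v , 22.47·√((D+1)³·𝒜₄/v⁴) + 1.596·ρ/v³ }. -/

import Mathlib

open MeasureTheory ProbabilityTheory Filter

noncomputable section

/-- `G` is a dependency graph of the family `Y`: whenever `V₁, V₂` are disjoint sets of
vertices with no edge of `G` between them, the families `(Y k)_{k ∈ V₁}` and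
`(Y k)_{k ∈ V₂}` are independent. -/
def IsDependencyGraph {Ω V E : Type*} [MeasurableSpace Ω] [MeasurableSpace E]
    (μ : Measure Ω) (G : SimpleGraph V) (Y : V → Ω → E) : Prop :=
  ∀ V₁ V₂ : Set V, Disjoint V₁ V₂ →
    (∀ i ∈ V₁, ∀ j ∈ V₂, ¬ G.Adj i j) →
    IndepFun (fun ω (i : V₁) => Y i.1 ω) (fun ω (j : V₂) => Y j.1 ω) μ

/-- Kolmogorov distance between the law of `W` under `μ` and the standard normal law. -/
def dKolNormal {Ω : Type*} [MeasurableSpace Ω] (μ : Measure Ω) (W : Ω → ℝ) : ℝ :=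
  ⨆ t : ℝ, |(μ {ω | W ω ≤ t}).toReal - (gaussianReal 0 1 (Set.Iic t)).toReal|


/-- Functions on words, with the shuffle product. -/
def Wd (V : Type*) := List V → ℝ

namespace Wd
variable {V : Type*}

instance : AddCommGroup (Wd V) := inferInstanceAs (AddCommGroup (List V → ℝ))
instance : PartialOrder (Wd V) := inferInstanceAs (PartialOrder (List V → ℝ))

/-- left shift (derivation) -/
def dl (j : V) (f : Wd V) : Wd V := fun l => f (j :: l)

/-- evaluation -/
def conv : List V → Wd V → Wd V → ℝ
  | [], f, g => f [] * g []
  | j :: C, f, g => conv C (dl j f) g + conv C f (dl j g)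

instance : Mul (Wd V) := ⟨fun f g C => conv C f g⟩
/-- constants -/
def cst (a : ℝ) : Wd V := fun l => match l with
  | [] => a
  | _ :: _ => 0
instance : One (Wd V) := ⟨cst 1⟩

@[ext] theorem ext {f g : Wd V} (h : ∀ C : List V, f C = g C) : f = g := funext h

theorem mul_nil (f g : Wd V) : (f * g) [] = f [] * g [] := rfl
theorem mul_cons (f g : Wd V) (j : V) (C : List V) :
    (f * g) (j :: C) = (dl j f * g) C + (f * dl j g) C := rfl
@[simp] theorem add_ap (f g : Wd V) (C : List V) : (f + g) C = f C + g C := rfl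
@[simp] theorem sub_ap (f g : Wd V) (C : List V) : (f - g) C = f C - g C := rfl
@[simp] theorem neg_ap (f : Wd V) (C : List V) : (-f) C = - f C := rfl
@[simp] theorem zero_ap (C : List V) : (0 : Wd V) C = 0 := rfl
@[simp] theorem one_nil : (1 : Wd V) [] = 1 := rfl
@[simp] theorem one_cons (j : V) (C : List V) : (1 : Wd V) (j :: C) = 0 := rfl
@[simp] theorem cst_nil (a : ℝ) : (cst a : Wd V) [] = a := rfl
@[simp] theorem cst_cons (a : ℝ) (j : V) (C : List V) : (cst a : Wd V) (j :: C) = 0 := rfl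
theorem dl_ap (j : V) (f : Wd V) (C : List V) : dl j f C = f (j :: C) := rfl
@[simp] theorem dl_add (j : V) (f g : Wd V) : dl j (f + g) = dl j f + dl j g := rfl
@[simp] theorem dl_sub (j : V) (f g : Wd V) : dl j (f - g) = dl j f - dl j g := rfl
@[simp] theorem dl_neg (j : V) (f : Wd V) : dl j (- f) = - dl j f := rfl
@[simp] theorem dl_zero (j : V) : dl j (0 : Wd V) = 0 := rfl
@[simp] theorem dl_one (j : V) : dl j (1 : Wd V) = 0 := rfl
@[simp] theorem dl_cst (j : V) (a : ℝ) : dl j (cst a : Wd V) = 0 := rfl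
theorem dl_mul' (j : V) (f g : Wd V) : dl j (f * g) = dl j f * g + f * dl j g := rfl

theorem mul_comm' (f g : Wd V) : f * g = g * f := by
  ext C
  induction C generalizing f g with
  | nil => simp [mul_nil, mul_comm]
  | cons j C ih => rw [mul_cons, mul_cons, ih, ih f, add_comm]

theorem add_mul' (f g h : Wd V) : (f + g) * h = f * h + g * h := by
  ext C
  induction C generalizing f g h with
  | nil => simp [mul_nil, add_mul]
  | cons j C ih =>
    simp only [mul_cons, add_ap, dl_add, ih]; ring

theorem mul_add' (f g h : Wd V) : f * (g + h) = f * g + f * h := by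
  rw [mul_comm', add_mul', mul_comm' g, mul_comm' h]

theorem mul_assoc' (f g h : Wd V) : f * g * h = f * (g * h) := by
  ext C
  induction C generalizing f g h with
  | nil => simp [mul_nil, mul_assoc]
  | cons j C ih =>
    simp only [mul_cons, dl_mul', add_mul', mul_add', add_ap, ih]; ring

theorem cst_mul (a : ℝ) (f : Wd V) (C : List V) : ((cst a : Wd V) * f) C = a * f C := by
  induction C generalizing f with
  | nil => simp [mul_nil]
  | cons j C ih =>
    have h0 : ∀ C : List V, ∀ f : Wd V, ((0 : Wd V) * f) C = 0 := by
      intro C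
      induction C with
      | nil => intro f; simp [mul_nil]
      | cons j C ih => intro f; rw [mul_cons, dl_zero, ih, ih, add_zero]
    rw [mul_cons, dl_cst, ih, h0, zero_add]; rfl

theorem one_mul' (f : Wd V) : 1 * f = f := by
  ext C; exact (cst_mul 1 f C).trans (one_mul _)

theorem zero_mul' (f : Wd V) : 0 * f = 0 := by
  have := add_mul' 0 0 f
  simpa using this

instance : CommRing (Wd V) :=
  { (inferInstance : AddCommGroup (Wd V)) with
    mul := (· * ·)
    one := 1
    mul_assoc := mul_assoc'
    mul_comm := mul_comm'
    left_distrib := mul_add'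
    right_distrib := add_mul'
    one_mul := one_mul'
    mul_one := fun f => by rw [mul_comm', one_mul']
    zero_mul := zero_mul'
    mul_zero := fun f => by rw [mul_comm', zero_mul'] }

theorem dl_mul (j : V) (f g : Wd V) : dl j (f * g) = dl j f * g + f * dl j g := rfl

theorem le_iff {f g : Wd V} : f ≤ g ↔ ∀ C, f C ≤ g C := Iff.rfl

theorem mul_nonneg' (f g : Wd V) (hf : 0 ≤ f) (hg : 0 ≤ g) : 0 ≤ f * g := by
  intro C
  change 0 ≤ (f * g) C
  induction C generalizing f g with
  | nil => exact mul_nonneg (hf []) (hg [])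
  | cons j C ih =>
    rw [mul_cons]
    exact add_nonneg (ih _ _ (fun l => hf (j :: l)) hg) (ih _ _ hf (fun l => hg (j :: l)))

instance : IsOrderedAddMonoid (Wd V) where
  add_le_add_left := fun f g h k C => by
    have := h C
    simp only [add_ap]; linarith

instance : ZeroLEOneClass (Wd V) where
  zero_le_one := fun C => by
    cases C with
    | nil => change (0:ℝ) ≤ 1; norm_num
    | cons j C => exact le_rfl

instance : IsOrderedRing (Wd V) := IsOrderedRing.of_mul_nonneg mul_nonneg'

theorem sum_ap {ι : Type*} (s : Finset ι) (f : ι → Wd V) (C : List V) :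
    (∑ i ∈ s, f i) C = ∑ i ∈ s, f i C := by
  classical
  induction s using Finset.induction_on with
  | empty => simp
  | insert a s ha ih => simp [Finset.sum_insert ha, ih]

theorem dl_sum {ι : Type*} (j : V) (s : Finset ι) (f : ι → Wd V) :
    dl j (∑ i ∈ s, f i) = ∑ i ∈ s, dl j (f i) := by
  ext C; simp only [dl_ap, sum_ap]

theorem dl_pow_succ (j : V) (f : Wd V) (n : ℕ) :
    dl j (f ^ (n+1)) = (n+1 : ℕ) * f ^ n * dl j f := by
  induction n with
  | zero => simp
  | succ n ih =>
    rw [pow_succ, dl_mul, ih]; push_cast; ring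

theorem cst_add (a b : ℝ) : (cst (a + b) : Wd V) = cst a + cst b := by
  ext C; cases C <;> simp
theorem cst_mul_cst (a b : ℝ) : (cst a * cst b : Wd V) = cst (a * b) := by
  ext C; rw [cst_mul]; cases C <;> simp
theorem cst_zero : (cst 0 : Wd V) = 0 := by
  ext C; cases C <;> simp
theorem cst_one : (cst 1 : Wd V) = 1 := rfl
theorem cst_natCast (n : ℕ) : (cst (n : ℝ) : Wd V) = n := by
  induction n with
  | zero => simp [cst_zero]
  | succ n ih => push_cast; rw [cst_add, ih, cst_one]
theorem cst_nonneg {a : ℝ} (h : 0 ≤ a) : (0 : Wd V) ≤ cst a := by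
  intro C; cases C
  · exact h
  · exact le_rfl
theorem natCast_mul_ap (n : ℕ) (f : Wd V) (C : List V) : ((n : Wd V) * f) C = n * f C := by
  rw [← cst_natCast, cst_mul]

/-- Locality of the product. -/
theorem mul_congr (U : V → Prop) {f f' g g' : Wd V} (n : ℕ) (C : List V) (hC : C.length ≤ n)
    (hU : ∀ c ∈ C, U c)
    (hf : ∀ D : List V, D.length ≤ n → (∀ c ∈ D, U c) → f D = f' D)
    (hg : ∀ D : List V, D.length ≤ n → (∀ c ∈ D, U c) → g D = g' D) :
    (f * g) C = (f' * g') C := by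
  induction C generalizing f f' g g' n with
  | nil => rw [mul_nil, mul_nil, hf [] (by simp) (by simp), hg [] (by simp) (by simp)]
  | cons j C ih =>
    obtain ⟨n, rfl⟩ : ∃ m, n = m + 1 := ⟨n - 1, by simp at hC; omega⟩
    have hj : U j := hU j (by simp)
    have hC' : C.length ≤ n := by simpa using hC
    have hU' : ∀ c ∈ C, U c := fun c hc => hU c (by simp [hc])
    rw [mul_cons, mul_cons]
    congr 1
    · refine ih n hC' hU' (fun D hD hDU => hf _ (by simpa using hD) ?_)
        (fun D hD hDU => hg _ (by omega) hDU)
      simpa [hj] using hDU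
    · refine ih n hC' hU' (fun D hD hDU => hf _ (by omega) hDU)
        (fun D hD hDU => hg _ (by simpa using hD) ?_)
      simpa [hj] using hDU

/-- Absolute value bound for products. -/
theorem abs_mul_le {f f' g g' : Wd V} (n : ℕ) (C : List V) (hC : C.length ≤ n)
    (hf : ∀ D : List V, D.length ≤ n → |f D| ≤ f' D)
    (hg : ∀ D : List V, D.length ≤ n → |g D| ≤ g' D) :
    |(f * g) C| ≤ (f' * g') C := by
  induction C generalizing f f' g g' n with
  | nil =>
    rw [mul_nil, mul_nil, abs_mul]
    exact mul_le_mul (hf [] (by simp)) (hg [] (by simp)) (abs_nonneg _)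
      ((abs_nonneg _).trans (hf [] (by simp)))
  | cons j C ih =>
    obtain ⟨n, rfl⟩ : ∃ m, n = m + 1 := ⟨n - 1, by simp at hC; omega⟩
    have hC' : C.length ≤ n := by simpa using hC
    rw [mul_cons, mul_cons]
    refine (abs_add_le _ _).trans (add_le_add ?_ ?_)
    · exact ih n hC' (fun D hD => hf _ (by simpa using hD)) (fun D hD => hg _ (by omega))
    · exact ih n hC' (fun D hD => hf _ (by omega)) (fun D hD => hg _ (by simpa using hD))

/-- permutation-invariant functions -/
def Sy (V : Type*) : Subring (Wd V) where
  carrier := {f | ∀ C C' : List V, C.Perm C' → f C = f C'}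
  mul_mem' := by
    intro f g hf hg C C' h
    have hd : ∀ (f : Wd V) (j : V), (∀ C C' : List V, C.Perm C' → f C = f C') →
        (∀ C C' : List V, C.Perm C' → dl j f C = dl j f C') :=
      fun f j hf C C' h => hf _ _ (h.cons j)
    simp only [Set.mem_ofPred_eq] at hf hg
    induction h generalizing f g with
    | nil => rfl
    | cons j h ih =>
      rw [mul_cons, mul_cons, ih (hd f j hf) hg, ih hf (hd g j hg)]
    | swap j l C =>
      have e : ∀ f : Wd V, (∀ C C' : List V, C.Perm C' → f C = f C') →
          dl l (dl j f) = dl j (dl l f) := by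
        intro f hf; ext D; exact hf _ _ (List.Perm.swap _ _ _)
      simp only [mul_cons, e f hf, e g hg]; ring
    | trans h1 h2 ih1 ih2 => rw [ih1 hf hg, ih2 hf hg]
  one_mem' := by
    intro C C' h
    cases C with
    | nil => rw [List.nil_perm.mp h]
    | cons j C =>
      cases C' with
      | nil => simp at h
      | cons => rfl
  add_mem' := by
    intro f g hf hg C C' h
    simp only [add_ap, hf C C' h, hg C C' h]
  zero_mem' := by intro C C' _; rfl
  neg_mem' := by
    intro f hf C C' h
    simp only [neg_ap, hf C C' h]

theorem mem_Sy {f : Wd V} : f ∈ Sy V ↔ ∀ C C' : List V, C.Perm C' → f C = f C' := Iff.rfl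

theorem cst_mem (a : ℝ) : (cst a : Wd V) ∈ Sy V := by
  intro C C' h
  cases C with
  | nil => rw [List.nil_perm.mp h]
  | cons j C =>
    cases C' with
    | nil => simp at h
    | cons => rfl

theorem pow_vanish {f : Wd V} (hf : f [] = 0) (g : Wd V) (m : ℕ) (C : List V) (h : C.length < m) :
    (f ^ m * g) C = 0 := by
  induction C generalizing m g with
  | nil =>
    obtain ⟨m, rfl⟩ : ∃ k, m = k + 1 := ⟨m - 1, by simp at h; omega⟩
    rw [pow_succ, mul_nil, mul_nil, hf]; ring
  | cons j C ih =>
    obtain ⟨m, rfl⟩ : ∃ k, m = k + 1 := ⟨m - 1, by simp at h; omega⟩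
    have h' : C.length < m := by simpa using h
    rw [mul_cons, dl_pow_succ, mul_assoc, mul_assoc, natCast_mul_ap, ih _ _ h', ih _ _ (by omega)]
    simp

/-- Inverse -/
def inv (M : Wd V) : Wd V := fun C => (∑ m ∈ Finset.range (C.length + 1), (1 - M) ^ m) C

theorem inv_eq (M : Wd V) (hM : M [] = 1) (n : ℕ) (C : List V) (h : C.length ≤ n) :
    inv M C = (∑ m ∈ Finset.range (n + 1), (1 - M) ^ m) C := by
  induction n with
  | zero =>
    have : C.length = 0 := by omega
    unfold inv; rw [this]
  | succ n ih =>
    rcases Nat.lt_or_ge n C.length with h' | h'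
    · have : C.length = n + 1 := by omega
      unfold inv; rw [this]
    · rw [Finset.sum_range_succ, add_ap, ← ih h']
      have := pow_vanish (f := 1 - M) (by simp [hM]) 1 (n+1) C (by omega)
      rw [mul_one] at this
      rw [this, add_zero]

theorem mul_inv (M : Wd V) (hM : M [] = 1) : M * inv M = 1 := by
  ext C
  rw [mul_congr (f' := M) (g' := ∑ m ∈ Finset.range (C.length + 1), (1 - M) ^ m)
    (fun _ => True) C.length C le_rfl (by simp) (fun _ _ _ => rfl)
    (fun D hD _ => inv_eq M hM _ D hD)]
  have h1 := mul_neg_geom_sum (1 - M) (C.length + 1)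
  have h2 : 1 - (1 - M) = M := by ring
  rw [h2] at h1
  rw [h1, sub_ap]
  have := pow_vanish (f := 1 - M) (by simp [hM]) 1 (C.length+1) C (by omega)
  rw [mul_one] at this
  rw [this, sub_zero]

theorem inv_mem {M : Wd V} (hM : M ∈ Sy V) : inv M ∈ Sy V := by
  intro C C' h
  unfold inv
  rw [h.length_eq]
  exact (Sy V).sum_mem (fun m _ => (Sy V).pow_mem ((Sy V).sub_mem (Sy V).one_mem hM) m) C C' h

end Wd

namespace Wd
variable {V : Type*}

/-! ### The connected correlations -/

/-- shift by a word -/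
def sh (F : List V) (f : Wd V) : Wd V := fun C => f (F ++ C)
/-- connected correlations -/
def RR (M : Wd V) (F : List V) : Wd V := sh F M * inv M

theorem dl_inv {M : Wd V} (hM : M [] = 1) (j : V) :
    dl j (inv M) = - (dl j M * inv M * inv M) := by
  have h := mul_inv M hM
  have h2 : dl j M * inv M + M * dl j (inv M) = 0 := by
    rw [← dl_mul, h]; rfl
  calc dl j (inv M) = (M * inv M) * dl j (inv M) := by rw [h, one_mul]
    _ = inv M * (dl j M * inv M + M * dl j (inv M)) - dl j M * inv M * inv M := by ring
    _ = _ := by rw [h2]; ring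

theorem dl_sh {M : Wd V} (j : V) (F : List V) : dl j (sh F M) = sh (F ++ [j]) M := by
  ext C; simp [dl, sh]

theorem dl_RR {M : Wd V} (hM : M [] = 1) (j : V) (F : List V) :
    dl j (RR M F) = RR M (F ++ [j]) - RR M F * RR M [j] := by
  unfold RR
  rw [dl_mul, dl_inv hM, dl_sh]
  have : sh [j] M = dl j M := rfl
  rw [this]; ring

theorem sh_mem {M : Wd V} (hM : M ∈ Sy V) (F : List V) : sh F M ∈ Sy V :=
  fun C C' h => hM _ _ (h.append_left F)

theorem RR_mem {M : Wd V} (hM : M ∈ Sy V) (F : List V) : RR M F ∈ Sy V :=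
  (Sy V).mul_mem (sh_mem hM F) (inv_mem hM)

theorem inv_nil {M : Wd V} : inv M [] = 1 := by
  simp [inv]

theorem RR_nil {M : Wd V} (F : List V) : RR M F [] = M F := by
  unfold RR
  rw [mul_nil, inv_nil, mul_one]; simp [sh]

/-- `RR` vanishes on disconnected words. -/
theorem RR_vanish {M : Wd V} (hM : M [] = 1) (nb : V → V → Prop)
    (hfac : ∀ F C : List V, (∀ v ∈ F, ∀ j ∈ C, ¬ nb v j) → M (F ++ C) = M F * M C)
    (F C : List V) (hC : C ≠ []) (h : ∀ v ∈ F, ∀ j ∈ C, ¬ nb v j) : RR M F C = 0 := by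
  unfold RR
  rw [mul_congr (f' := cst (M F) * M) (g' := inv M) (fun j => ∀ v ∈ F, ¬ nb v j)
    C.length C le_rfl (fun c hc v hv => h v hv c hc) ?_ (fun _ _ _ => rfl),
    mul_assoc, mul_inv M hM, mul_one]
  · cases C with
    | nil => exact absurd rfl hC
    | cons => rfl
  · intro D _ hD
    rw [cst_mul]
    exact hfac F D (fun v hv j hj => hD j hj v hv)

/-! ### The tree majorants -/
variable [DecidableEq V]
/-- coordinate -/
def zz (j : V) : Wd V := fun C => if C = [j] then 1 else 0

theorem dl_zz (l j : V) : dl l (zz j) = cst (if l = j then 1 else 0) := by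
  ext C
  cases C with
  | nil => simp [dl, zz]
  | cons a C => simp [dl, zz]

theorem zz_nonneg (j : V) : 0 ≤ zz j := by
  intro C; change (0:ℝ) ≤ zz j C; unfold zz; split_ifs <;> norm_num

theorem zz_mem (j : V) : zz j ∈ Sy V := by
  intro C C' h
  unfold zz
  have : C = [j] ↔ C' = [j] := by
    constructor
    · rintro rfl; exact List.singleton_perm.mp h |>.symm
    · rintro rfl; exact List.perm_singleton.mp h
  simp only [this]

/-- truncated exponential -/
def ex (N : ℕ) (g : Wd V) : Wd V := ∑ m ∈ Finset.range (N + 1), cst ((m.factorial : ℝ)⁻¹) * g ^ m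

theorem ex_mono {N N' : ℕ} {g g' : Wd V} (h : N ≤ N') (h0 : 0 ≤ g) (hg : g ≤ g') :
    ex N g ≤ ex N' g' := by
  unfold ex
  calc _ ≤ ∑ m ∈ Finset.range (N + 1), cst ((m.factorial : ℝ)⁻¹) * g' ^ m := by
        refine Finset.sum_le_sum fun m _ => ?_
        refine mul_le_mul_of_nonneg_left ?_ (cst_nonneg (by positivity))
        exact pow_le_pow_left₀ h0 hg m
    _ ≤ _ := by
        refine Finset.sum_le_sum_of_subset_of_nonneg ?_ ?_
        · intro m; simp; omega
        · intro m _ _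
          exact mul_nonneg (cst_nonneg (by positivity)) (pow_nonneg (h0.trans hg) m)

theorem ex_nonneg {N : ℕ} {g : Wd V} (h0 : 0 ≤ g) : 0 ≤ ex N g :=
  Finset.sum_nonneg fun m _ => mul_nonneg (cst_nonneg (by positivity)) (pow_nonneg h0 m)

theorem dl_ex (j : V) (N : ℕ) (g : Wd V) : dl j (ex (N+1) g) = ex N g * dl j g := by
  unfold ex
  rw [Finset.sum_range_succ', dl_add, dl_sum, Finset.sum_mul]
  have : dl j ((cst ((Nat.factorial 0 : ℝ)⁻¹) : Wd V) * g ^ 0) = 0 := by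
    rw [pow_zero, mul_one]; rfl
  rw [this, add_zero]
  refine Finset.sum_congr rfl fun m _ => ?_
  rw [dl_mul, dl_cst, zero_mul, zero_add, dl_pow_succ, ← cst_natCast, ← mul_assoc, ← mul_assoc,
    cst_mul_cst]
  congr 3
  rw [Nat.factorial_succ]; push_cast; field_simp

variable (nb : V → Finset V)

/-- tree series -/
def uu : ℕ → V → Wd V
  | 0, _ => 1
  | n+1, v => ex (n+1) (∑ j ∈ nb v, zz j * uu n j)

theorem uu_succ (n : ℕ) (v : V) : uu nb (n+1) v = ex (n+1) (∑ j ∈ nb v, zz j * uu nb n j) := rfl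

theorem uu_nonneg (n : ℕ) (v : V) : 0 ≤ uu nb n v := by
  induction n generalizing v with
  | zero => exact zero_le_one
  | succ n ih => exact ex_nonneg (Finset.sum_nonneg fun j _ => mul_nonneg (zz_nonneg j) (ih j))

theorem uu_mem (n : ℕ) (v : V) : uu nb n v ∈ Sy V := by
  induction n generalizing v with
  | zero => exact (Sy V).one_mem
  | succ n ih =>
    rw [uu_succ, ex]
    exact (Sy V).sum_mem fun m _ => (Sy V).mul_mem (cst_mem _) ((Sy V).pow_mem
      ((Sy V).sum_mem fun j _ => (Sy V).mul_mem (zz_mem j) (ih j)) m)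

theorem gg_nonneg (n : ℕ) (v : V) : 0 ≤ ∑ j ∈ nb v, zz j * uu nb n j :=
  Finset.sum_nonneg fun j _ => mul_nonneg (zz_nonneg j) (uu_nonneg nb n j)

theorem uu_mono (n : ℕ) (v : V) : uu nb n v ≤ uu nb (n+1) v := by
  induction n generalizing v with
  | zero =>
    have : uu nb 0 v = ex 0 (∑ j ∈ nb v, zz j * uu nb 0 j) := by
      simp [uu, ex, cst_one]
    rw [this]
    exact ex_mono (by omega) (gg_nonneg nb 0 v) le_rfl
  | succ n ih =>
    exact ex_mono (by omega) (gg_nonneg nb n v)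
      (Finset.sum_le_sum fun j _ => mul_le_mul_of_nonneg_left (ih j) (zz_nonneg j))

theorem uu_le_ex (n : ℕ) (v : V) : uu nb n v ≤ ex n (∑ j ∈ nb v, zz j * uu nb n j) := by
  cases n with
  | zero => simp [uu, ex, cst_one]
  | succ n =>
    exact ex_mono le_rfl (gg_nonneg nb n v)
      (Finset.sum_le_sum fun j _ => mul_le_mul_of_nonneg_left (uu_mono nb n j) (zz_nonneg j))

theorem dl_nonneg {f : Wd V} (hf : 0 ≤ f) (j : V) : 0 ≤ dl j f := fun C => hf (j :: C)

theorem dl_uu (n : ℕ) (v j : V) (hj : j ∈ nb v) :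
    uu nb n v * uu nb n j ≤ dl j (uu nb (n+1) v) := by
  rw [uu_succ, dl_ex]
  refine mul_le_mul (uu_le_ex nb n v) ?_ (uu_nonneg nb n j) (ex_nonneg (gg_nonneg nb n v))
  rw [dl_sum]
  calc uu nb n j ≤ dl j (zz j * uu nb n j) := by
        rw [dl_mul, dl_zz]; simp only [if_true, cst_one, one_mul]
        exact le_add_of_nonneg_right (mul_nonneg (zz_nonneg j) (dl_nonneg (uu_nonneg nb n j) j))
    _ ≤ _ := Finset.single_le_sum (f := fun i => dl j (zz i * uu nb n i))
        (fun i _ => dl_nonneg (mul_nonneg (zz_nonneg i) (uu_nonneg nb n i)) j) hj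

/-- product over a word -/
def PP (n : ℕ) (F : List V) : Wd V := (F.map (uu nb n)).prod

theorem PP_cons (n : ℕ) (a : V) (F : List V) : PP nb n (a :: F) = uu nb n a * PP nb n F := by
  simp [PP]

theorem PP_nonneg (n : ℕ) (F : List V) : 0 ≤ PP nb n F := by
  induction F with
  | nil => exact zero_le_one
  | cons a F ih => rw [PP_cons]; exact mul_nonneg (uu_nonneg nb n a) ih

theorem PP_mem (n : ℕ) (F : List V) : PP nb n F ∈ Sy V := by
  induction F with
  | nil => exact (Sy V).one_mem
  | cons a F ih => rw [PP_cons]; exact (Sy V).mul_mem (uu_mem nb n a) ih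

theorem PP_mono (n : ℕ) (F : List V) : PP nb n F ≤ PP nb (n+1) F := by
  induction F with
  | nil => exact le_rfl
  | cons a F ih =>
    rw [PP_cons, PP_cons]
    exact mul_le_mul (uu_mono nb n a) ih (PP_nonneg nb n F) (uu_nonneg nb (n+1) a)

theorem dl_PP (n : ℕ) (F : List V) (v j : V) (hv : v ∈ F) (hj : j ∈ nb v) :
    PP nb n F * uu nb n j ≤ dl j (PP nb (n+1) F) := by
  induction F with
  | nil => simp at hv
  | cons a F ih =>
    rw [PP_cons, PP_cons, dl_mul]
    rcases List.mem_cons.mp hv with rfl | hv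
    · calc _ = uu nb n v * uu nb n j * PP nb n F := by ring
        _ ≤ dl j (uu nb (n+1) v) * PP nb (n+1) F :=
          mul_le_mul (dl_uu nb n v j hj) (PP_mono nb n F) (PP_nonneg nb n F)
            (dl_nonneg (uu_nonneg nb (n+1) v) j)
        _ ≤ _ := le_add_of_nonneg_right
          (mul_nonneg (uu_nonneg nb (n+1) v) (dl_nonneg (PP_nonneg nb (n+1) F) j))
    · calc _ = uu nb n a * (PP nb n F * uu nb n j) := by ring
        _ ≤ uu nb (n+1) a * dl j (PP nb (n+1) F) :=
          mul_le_mul (uu_mono nb n a) (ih hv) (mul_nonneg (PP_nonneg nb n F) (uu_nonneg nb n j))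
            (uu_nonneg nb (n+1) a)
        _ ≤ _ := le_add_of_nonneg_left
          (mul_nonneg (dl_nonneg (uu_nonneg nb (n+1) a) j) (PP_nonneg nb (n+1) F))

theorem uu_nil (n : ℕ) (v : V) : uu nb n v [] = 1 := by
  induction n generalizing v with
  | zero => rfl
  | succ n ih =>
    have hg : (∑ j ∈ nb v, zz j * uu nb n j) [] = 0 := by
      rw [sum_ap]; simp [mul_nil, zz]
    have hp : ∀ m : ℕ, ((∑ j ∈ nb v, zz j * uu nb n j) ^ (m+1)) [] = 0 := by
      intro m; rw [pow_succ, mul_nil, hg, mul_zero]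
    rw [uu_succ, ex, Finset.sum_range_succ', add_ap, sum_ap]
    simp [mul_nil, hp]

theorem PP_nil (n : ℕ) (F : List V) : PP nb n F [] = 1 := by
  induction F with
  | nil => rfl
  | cons a F ih => rw [PP_cons, mul_nil, uu_nil, ih, one_mul]

/-! ### Weights -/
/-- weight of a word -/
def wt (ξ : V → ℝ) (C : List V) : ℝ := (C.map ξ).prod
/-- weighted function -/
def wf (ξ : V → ℝ) (f : Wd V) : Wd V := fun C => wt ξ C * f C

theorem dl_wf (ξ : V → ℝ) (f : Wd V) (j : V) : dl j (wf ξ f) = cst (ξ j) * wf ξ (dl j f) := by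
  ext C
  rw [cst_mul]
  simp [dl, wf, wt, mul_assoc]

theorem wf_mul (ξ : V → ℝ) (f g : Wd V) : wf ξ f * wf ξ g = wf ξ (f * g) := by
  ext C
  induction C generalizing f g with
  | nil => simp [wf, wt, mul_nil]
  | cons j C ih =>
    have e1 : wf ξ f * (cst (ξ j) * wf ξ (dl j g)) = cst (ξ j) * (wf ξ f * wf ξ (dl j g)) := by
      ring
    rw [mul_cons, dl_wf, dl_wf, e1, mul_assoc, cst_mul, cst_mul, ih, ih]
    simp only [wf, wt, List.map_cons, List.prod_cons, mul_cons]; ring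

theorem wt_nonneg {ξ : V → ℝ} (h : ∀ v, 0 ≤ ξ v) (C : List V) : 0 ≤ wt ξ C := by
  unfold wt
  apply List.prod_nonneg
  intro a ha
  obtain ⟨v, _, rfl⟩ := List.mem_map.mp ha
  exact h v

theorem wt_perm {ξ : V → ℝ} {C C' : List V} (h : C.Perm C') : wt ξ C = wt ξ C' :=
  (h.map ξ).prod_eq

/-- Main connected-correlation bound -/
theorem RR_bound {M : Wd V} (hM : M [] = 1) (hS : M ∈ Sy V)
    (hfac : ∀ F C : List V, (∀ v ∈ F, ∀ j ∈ C, j ∉ nb v) → M (F ++ C) = M F * M C)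
    (ξ : V → ℝ) (hξ : ∀ v, 0 ≤ ξ v) (r : ℕ)
    (hb : ∀ C : List V, C.length ≤ r → |M C| ≤ wt ξ C) (n : ℕ) :
    ∀ F C : List V, C.length ≤ n → F.length + C.length ≤ r →
    |RR M F C| ≤ wt ξ F * (wt (fun v => 2 * ξ v) C * PP nb n F C) := by
  have h2 : ∀ v, 0 ≤ 2 * ξ v := fun v => by have := hξ v; linarith
  have hnil : ∀ (n : ℕ) (F : List V), F.length ≤ r →
      |RR M F []| ≤ wt ξ F * (wt (fun v => 2 * ξ v) [] * PP nb n F []) := by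
    intro n F hF
    rw [RR_nil, PP_nil]
    simpa [wt] using hb F hF
  induction n with
  | zero =>
    intro F C hC hr
    obtain rfl : C = [] := List.length_eq_zero_iff.mp (by omega)
    exact hnil 0 F (by simpa using hr)
  | succ n ih =>
    intro F C hC hr
    by_cases hC0 : C = []
    · subst hC0
      exact hnil (n+1) F (by simpa using hr)
    by_cases hadj : ∀ v ∈ F, ∀ j ∈ C, j ∉ nb v
    · rw [RR_vanish hM (fun v j => j ∈ nb v) hfac F C hC0 hadj, abs_zero]
      exact mul_nonneg (wt_nonneg hξ F) (mul_nonneg (wt_nonneg h2 C) (PP_nonneg nb _ F C))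
    push Not at hadj
    obtain ⟨v, hv, j, hj, hjv⟩ := hadj
    obtain ⟨C', hp⟩ : ∃ C', C.Perm (j :: C') := ⟨C.erase j, List.perm_cons_erase hj⟩
    have hlen := hp.length_eq
    simp only [List.length_cons] at hlen
    rw [RR_mem hS F C _ hp, wt_perm hp, PP_mem nb _ F C _ hp]
    have hF1 : 1 ≤ F.length := List.length_pos_of_mem hv
    have e1 : RR M F (j :: C') = RR M (F ++ [j]) C' - (RR M F * RR M [j]) C' := by
      have h := congrFun (dl_RR hM j F) C'
      exact h
    rw [e1]
    have b1 := ih (F ++ [j]) C' (by omega) (by simp; omega)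
    have b2 : |(RR M F * RR M [j]) C'| ≤
        (((cst (wt ξ F) : Wd V) * wf (fun v => 2 * ξ v) (PP nb n F)) *
          (cst (ξ j) * wf (fun v => 2 * ξ v) (PP nb n [j])) : Wd V) C' := by
      refine abs_mul_le C'.length C' le_rfl ?_ ?_
      · intro D hD
        rw [cst_mul]
        exact ih F D (by omega) (by omega)
      · intro D hD
        rw [cst_mul]
        have := ih [j] D (by omega) (by simp; omega)
        have w1 : wt ξ [j] = ξ j := by simp [wt]
        rw [w1] at this
        exact this
    have e2 : (((cst (wt ξ F) : Wd V) * wf (fun v => 2 * ξ v) (PP nb n F)) *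
          (cst (ξ j) * wf (fun v => 2 * ξ v) (PP nb n [j])) : Wd V) C' =
        wt ξ F * ξ j * (wt (fun v => 2 * ξ v) C' * (PP nb n F * uu nb n j) C') := by
      have : PP nb n [j] = uu nb n j := by simp [PP]
      rw [this, mul_mul_mul_comm, cst_mul_cst, wf_mul, cst_mul]; rfl
    have e3 : PP nb n (F ++ [j]) = PP nb n F * uu nb n j := by simp [PP]
    have e4 : wt ξ (F ++ [j]) = wt ξ F * ξ j := by simp [wt]
    rw [e2] at b2
    rw [e3, e4] at b1
    have b3 : (PP nb n F * uu nb n j) C' ≤ PP nb (n+1) F (j :: C') := dl_PP nb n F v j hv hjv C'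
    have e5 : wt (fun v => 2 * ξ v) (j :: C') = 2 * ξ j * wt (fun v => 2 * ξ v) C' := by simp [wt]
    rw [e5]
    calc _ ≤ _ := abs_sub _ _
      _ ≤ _ := add_le_add b1 b2
      _ = wt ξ F * (2 * ξ j * wt (fun v => 2 * ξ v) C' * (PP nb n F * uu nb n j) C') := by ring
      _ ≤ _ := by
        refine mul_le_mul_of_nonneg_left (mul_le_mul_of_nonneg_left b3 ?_) (wt_nonneg hξ F)
        exact mul_nonneg (h2 j) (wt_nonneg h2 C')

end Wd

namespace Wd
variable {V : Type*}

/-! ### Summation over all words -/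
section tau
variable [Fintype V]

/-- sum over words of given length -/
def tauA : List Unit → Wd V → ℝ
  | [], f => f []
  | _ :: C, f => ∑ v : V, tauA C (dl v f)

/-- sum over words -/
def tauF (f : Wd V) : Wd Unit := fun C => tauA C f

theorem tauF_nil (f : Wd V) : tauF f [] = f [] := rfl
theorem tauF_cons (f : Wd V) (u : Unit) (C : List Unit) :
    tauF f (u :: C) = ∑ v : V, tauF (dl v f) C := rfl
theorem dl_tauF (f : Wd V) (u : Unit) : dl u (tauF f) = ∑ v : V, tauF (dl v f) := by
  ext C; rw [sum_ap]; rfl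

theorem tauF_add (f g : Wd V) : tauF (f + g) = tauF f + tauF g := by
  ext C
  induction C generalizing f g with
  | nil => rfl
  | cons u C ih =>
    rw [add_ap, tauF_cons, tauF_cons, tauF_cons, ← Finset.sum_add_distrib]
    refine Finset.sum_congr rfl fun v _ => ?_
    rw [dl_add, ih, add_ap]

theorem tauF_mul (f g : Wd V) : tauF (f * g) = tauF f * tauF g := by
  ext C
  induction C generalizing f g with
  | nil => rfl
  | cons u C ih =>
    rw [mul_cons, dl_tauF, dl_tauF, Finset.sum_mul, Finset.mul_sum, sum_ap, sum_ap,
      tauF_cons, ← Finset.sum_add_distrib]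
    refine Finset.sum_congr rfl fun v _ => ?_
    rw [dl_mul, tauF_add, add_ap, ih, ih]

theorem tauF_zero : tauF (0 : Wd V) = 0 := by
  have := tauF_add (0 : Wd V) 0
  simpa using this

theorem tauF_cst (a : ℝ) : tauF (cst a : Wd V) = cst a := by
  ext C
  cases C with
  | nil => rfl
  | cons u C =>
    rw [tauF_cons, cst_cons]
    refine Finset.sum_eq_zero fun v _ => ?_
    rw [dl_cst, tauF_zero]; rfl

/-- the homomorphism -/
def tau : Wd V →+* Wd Unit where
  toFun := tauF
  map_one' := tauF_cst 1
  map_mul' := tauF_mul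
  map_zero' := tauF_zero
  map_add' := tauF_add

theorem tau_nil (f : Wd V) : tau f [] = f [] := rfl
theorem tau_cons (f : Wd V) (u : Unit) (C : List Unit) :
    tau f (u :: C) = ∑ v : V, tau (dl v f) C := rfl
theorem dl_tau (f : Wd V) (u : Unit) : dl u (tau f) = ∑ v : V, tau (dl v f) := dl_tauF f u
theorem tau_cst (a : ℝ) : tau (cst a : Wd V) = cst a := tauF_cst a

theorem tau_abs_le (f g : Wd V) (C : List Unit) (h : ∀ D : List V, D.length = C.length → |f D| ≤ g D) :
    |tau f C| ≤ tau g C := by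
  induction C generalizing f g with
  | nil => exact h [] rfl
  | cons u C ih =>
    rw [tau_cons, tau_cons]
    refine (Finset.abs_sum_le_sum_abs _ _).trans (Finset.sum_le_sum fun v _ => ?_)
    exact ih _ _ fun D hD => h (v :: D) (by simp [hD])

theorem tau_mono {f g : Wd V} (h : f ≤ g) : tau f ≤ tau g := by
  intro C
  have h0 : ∀ C : List Unit, ∀ f g : Wd V, f ≤ g → tau f C ≤ tau g C := by
    intro C
    induction C with
    | nil => intro f g h; exact h []
    | cons u C ih =>
      intro f g h
      rw [tau_cons, tau_cons]
      exact Finset.sum_le_sum fun v _ => ih _ _ fun D => h (v :: D)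
  exact h0 C f g h

variable [DecidableEq V]

theorem tau_zz (j : V) : tau (zz j) = zz () := by
  ext C
  cases C with
  | nil => rfl
  | cons u C =>
    rw [tau_cons]
    simp_rw [dl_zz, tau_cst]
    have h1 : zz () (u :: C) = (cst 1 : Wd Unit) C := by
      have : dl u (zz ()) = (cst 1 : Wd Unit) := by rw [dl_zz]; simp
      rw [← this]; rfl
    rw [h1]
    cases C with
    | nil => simp
    | cons => simp

theorem tau_ex (N : ℕ) (g : Wd V) : tau (ex N g) = ex N (tau g) := by
  unfold ex
  rw [map_sum]
  refine Finset.sum_congr rfl fun m _ => ?_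
  rw [map_mul, map_pow, tau_cst]

end tau

/-- scalar tree series -/
def aa (Q : ℝ) : ℕ → Wd Unit
  | 0 => 1
  | n+1 => ex (n+1) (cst Q * zz () * aa Q n)

theorem aa_nonneg {Q : ℝ} (hQ : 0 ≤ Q) (n : ℕ) : 0 ≤ aa Q n := by
  induction n with
  | zero => exact zero_le_one
  | succ n ih => exact ex_nonneg (mul_nonneg (mul_nonneg (cst_nonneg hQ) (zz_nonneg _)) ih)

theorem tau_uu [Fintype V] [DecidableEq V] (nb : V → Finset V) (Q : ℕ) (hQ : ∀ v, (nb v).card ≤ Q)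
    (n : ℕ) (v : V) : tau (uu nb n v) ≤ aa Q n := by
  induction n generalizing v with
  | zero => exact (map_one (tau (V := V))).le
  | succ n ih =>
    rw [uu_succ, tau_ex]
    refine ex_mono le_rfl ?_ ?_
    · rw [← map_zero (tau (V := V))]; exact tau_mono (gg_nonneg nb n v)
    · rw [map_sum]
      have ha : 0 ≤ zz () * aa (Q:ℝ) n := mul_nonneg (zz_nonneg _) (aa_nonneg (by positivity) n)
      calc _ ≤ ∑ j ∈ nb v, zz () * aa (Q : ℝ) n := by
            refine Finset.sum_le_sum fun j _ => ?_
            rw [map_mul, tau_zz]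
            exact mul_le_mul_of_nonneg_left (ih j) (zz_nonneg _)
        _ = ((nb v).card : Wd Unit) * (zz () * aa (Q : ℝ) n) := by
            rw [Finset.sum_const, nsmul_eq_mul]
        _ ≤ (Q : Wd Unit) * (zz () * aa (Q : ℝ) n) := by
            exact mul_le_mul_of_nonneg_right (Nat.mono_cast (hQ v)) ha
        _ = _ := by rw [cst_natCast, mul_assoc]

/-- coefficient -/
def ev (p : Wd Unit) (n : ℕ) : ℝ := p (List.replicate n ())

theorem ev_succ (p : Wd Unit) (n : ℕ) : ev p (n+1) = ev (dl () p) n := rfl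

theorem ev_z_mul (p : Wd Unit) (n : ℕ) : ev (zz () * p) n = n * ev p (n-1) := by
  induction n generalizing p with
  | zero => simp [ev, mul_nil, zz]
  | succ n ih =>
    rw [ev_succ, dl_mul, dl_zz]
    simp only [if_true, cst_one, one_mul]
    have : ev (p + zz () * dl () p) n = ev p n + ev (zz () * dl () p) n := rfl
    rw [this, ih]
    cases n with
    | zero => simp
    | succ n =>
      simp only [Nat.add_sub_cancel]
      rw [← ev_succ]; push_cast; ring

theorem ev_zpow_mul (m : ℕ) (p : Wd Unit) (n : ℕ) :
    ev (zz () ^ m * p) n = n.descFactorial m * ev p (n-m) := by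
  induction m generalizing n with
  | zero => simp
  | succ m ih =>
    rw [pow_succ', mul_assoc, ev_z_mul, ih]
    cases n with
    | zero => simp
    | succ n =>
      rw [Nat.succ_descFactorial_succ]
      simp only [Nat.add_sub_cancel, Nat.add_sub_add_right]
      push_cast; ring

/-- `exp (f y)` truncated -/
def EE (y : Wd Unit) (f : ℝ) (K : ℕ) : Wd Unit :=
  ∑ m ∈ Finset.range K, cst (f ^ m / (m.factorial : ℝ)) * y ^ m

theorem EE_mul {y : Wd Unit} (hy : 0 ≤ y) {f : ℝ} (hf : 0 ≤ f) (K K' : ℕ) :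
    EE y 1 K * EE y f K' ≤ EE y (1 + f) (K + K') := by
  unfold EE
  rw [Finset.sum_mul_sum, ← Finset.sum_product']
  have hmap : ∀ x ∈ Finset.range K ×ˢ Finset.range K', x.1 + x.2 ∈ Finset.range (K + K') := by
    intro x hx; simp at hx ⊢; omega
  rw [← Finset.sum_fiberwise_of_maps_to hmap]
  refine Finset.sum_le_sum fun m _ => ?_
  calc _ ≤ ∑ x ∈ Finset.HasAntidiagonal.antidiagonal m, cst (1 ^ x.1 / (x.1.factorial : ℝ)) * y ^ x.1 *
        (cst (f ^ x.2 / (x.2.factorial : ℝ)) * y ^ x.2) := by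
        refine Finset.sum_le_sum_of_subset_of_nonneg ?_ ?_
        · intro x hx
          simp at hx ⊢; exact hx.2
        · intro x _ _
          exact mul_nonneg (mul_nonneg (cst_nonneg (by positivity)) (pow_nonneg hy _))
            (mul_nonneg (cst_nonneg (by positivity)) (pow_nonneg hy _))
    _ = ∑ x ∈ Finset.HasAntidiagonal.antidiagonal m,
          cst (1 ^ x.1 / (x.1.factorial : ℝ) * (f ^ x.2 / (x.2.factorial : ℝ))) * y ^ m := by
        refine Finset.sum_congr rfl fun x hx => ?_
        rw [← Finset.HasAntidiagonal.mem_antidiagonal.mp hx, pow_add, ← cst_mul_cst]; ring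
    _ = _ := by
        rw [← Finset.sum_mul]
        congr 1
        ext C
        rw [sum_ap]
        cases C with
        | cons => simp
        | nil =>
          simp only [cst_nil]
          rw [(Commute.all (1:ℝ) f).add_pow', Finset.sum_div]
          refine Finset.sum_congr rfl fun x hx => ?_
          have h := Nat.add_choose_mul_factorial_mul_factorial x.1 x.2
          rw [Finset.HasAntidiagonal.mem_antidiagonal.mp hx] at h
          rw [← h, nsmul_eq_mul]
          have h0 : (m.choose x.1 : ℝ) ≠ 0 := by
            have := Finset.HasAntidiagonal.mem_antidiagonal.mp hx
            exact_mod_cast (Nat.choose_pos (by omega)).ne'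
          have hs : m.choose x.1 = m.choose x.2 := by
            have := Finset.HasAntidiagonal.mem_antidiagonal.mp hx
            exact Nat.choose_symm_of_eq_add (by omega)
          rw [hs] at h0 ⊢
          push_cast
          field_simp

theorem EE_nonneg {y : Wd Unit} (hy : 0 ≤ y) {f : ℝ} (hf : 0 ≤ f) (K : ℕ) : 0 ≤ EE y f K :=
  Finset.sum_nonneg fun m _ => mul_nonneg (cst_nonneg (by positivity)) (pow_nonneg hy m)

theorem ex_pow_le {y : Wd Unit} (hy : 0 ≤ y) (M f : ℕ) :
    ∃ K, (ex M y) ^ f ≤ EE y f K := by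
  induction f with
  | zero =>
    refine ⟨1, ?_⟩
    simp [EE, cst_one]
  | succ f ih =>
    obtain ⟨K, hK⟩ := ih
    refine ⟨(M+1) + K, ?_⟩
    have e : ex M y = EE y 1 (M+1) := by
      unfold ex EE; refine Finset.sum_congr rfl fun m _ => ?_; simp
    calc (ex M y) ^ (f+1) = ex M y * ex M y ^ f := pow_succ' _ _
      _ ≤ EE y 1 (M+1) * EE y f K := by
        rw [← e]; exact mul_le_mul_of_nonneg_left hK (ex_nonneg hy)
      _ ≤ EE y (1 + f) (M + 1 + K) := EE_mul hy (by positivity) _ _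
      _ = _ := by push_cast; rw [add_comm (1:ℝ)]

/-- the tree count -/
def th (f n : ℕ) : ℝ := if n = 0 then 1 else f * (f + n : ℝ) ^ (n-1)

theorem th_sum (f n : ℕ) :
    ∑ m ∈ Finset.range (n+1), (n.choose m : ℝ) * f ^ m * th m (n-m) = th f n := by
  cases n with
  | zero => simp [th]
  | succ n =>
    rw [Finset.sum_range_succ']
    have h0 : ((n+1).choose 0 : ℝ) * f ^ 0 * th 0 (n+1-0) = 0 := by simp [th]
    rw [h0, add_zero]
    have h1 : th f (n+1) = f * (f + (n+1 : ℕ) : ℝ) ^ n := by simp [th]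
    rw [h1, add_pow, Finset.mul_sum]
    refine Finset.sum_congr rfl fun k hk => ?_
    have hk : k ≤ n := by simp at hk; omega
    have hc : ((n+1).choose (k+1) : ℝ) * (k+1) = (n+1) * n.choose k := by
      have := Nat.add_one_mul_choose_eq n k
      exact_mod_cast this.symm
    by_cases hkn : k = n
    · subst hkn
      simp [th, pow_succ]; ring
    · have h2 : n + 1 - (k+1) ≠ 0 := by omega
      rw [th, if_neg h2]
      have h3 : n - k = (n + 1 - (k + 1) - 1) + 1 := by omega
      have h4 : ((k+1 : ℕ) : ℝ) + ((n + 1 - (k+1) : ℕ) : ℝ) = (n+1 : ℕ) := by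
        rw [← Nat.cast_add]; congr 1; omega
      rw [h4, h3, pow_succ]
      generalize n + 1 - (k + 1) - 1 = e
      push_cast
      calc _ = (((n+1).choose (k+1) : ℝ) * (k+1)) * f ^ (k+1) * (n+1 : ℝ) ^ e := by
            ring
        _ = _ := by rw [hc]; ring

theorem th_nonneg (f n : ℕ) : 0 ≤ th f n := by
  unfold th; split_ifs <;> positivity

theorem ev_mono {p q : Wd Unit} (h : p ≤ q) (n : ℕ) : ev p n ≤ ev q n := h _
theorem ev_cst_mul (a : ℝ) (p : Wd Unit) (n : ℕ) : ev (cst a * p) n = a * ev p n := cst_mul _ _ _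

theorem aa_bound {Q : ℝ} (hQ : 0 ≤ Q) (N f n : ℕ) : ev (aa Q N ^ f) n ≤ th f n * Q ^ n := by
  induction N generalizing f n with
  | zero =>
    have : aa Q 0 = 1 := rfl
    rw [this, one_pow]
    cases n with
    | zero =>
      have : ev 1 0 = 1 := rfl
      rw [this]; simp [th]
    | succ n =>
      have : ev 1 (n+1) = 0 := rfl
      rw [this]
      exact mul_nonneg (th_nonneg _ _) (pow_nonneg hQ _)
  | succ N ih =>
    have hy : 0 ≤ cst Q * zz () * aa Q N :=
      mul_nonneg (mul_nonneg (cst_nonneg hQ) (zz_nonneg _)) (aa_nonneg hQ N)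
    obtain ⟨K, hK⟩ := ex_pow_le hy (N+1) f
    refine (ev_mono hK n).trans ?_
    have e1 : ev (EE (cst Q * zz () * aa Q N) f K) n =
        ∑ m ∈ Finset.range K, (f:ℝ) ^ m / (m.factorial : ℝ) *
          (Q ^ m * (n.descFactorial m * ev (aa Q N ^ m) (n-m))) := by
      unfold EE
      have : ∀ s : Finset ℕ, ∀ F : ℕ → Wd Unit, ev (∑ m ∈ s, F m) n = ∑ m ∈ s, ev (F m) n :=
        fun s F => sum_ap _ _ _
      rw [this]
      refine Finset.sum_congr rfl fun m _ => ?_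
      have hc : ∀ m : ℕ, (cst Q : Wd Unit) ^ m = cst (Q ^ m) := by
        intro m
        induction m with
        | zero => simp [cst_one]
        | succ m ih => rw [pow_succ, ih, cst_mul_cst, pow_succ]
      rw [ev_cst_mul, mul_pow, mul_pow, hc, mul_assoc, ev_cst_mul, ev_zpow_mul]
    rw [e1]
    have e2 : ∀ m, (f:ℝ) ^ m / (m.factorial : ℝ) *
          (Q ^ m * (n.descFactorial m * ev (aa Q N ^ m) (n-m))) ≤
          if m ∈ Finset.range (n+1) then (n.choose m : ℝ) * f ^ m * th m (n-m) * Q ^ n else 0 := by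
      intro m
      split_ifs with hm
      · have hm : m ≤ n := by simp at hm; omega
        have h1 : (n.descFactorial m : ℝ) = m.factorial * n.choose m := by
          exact_mod_cast Nat.descFactorial_eq_factorial_mul_choose n m
        have h2 : Q ^ n = Q ^ m * Q ^ (n-m) := by rw [← pow_add]; congr 1; omega
        rw [h1, h2]
        have hf : (m.factorial : ℝ) ≠ 0 := by positivity
        calc _ = (n.choose m : ℝ) * f ^ m * Q ^ m * ev (aa Q N ^ m) (n-m) := by field_simp
          _ ≤ (n.choose m : ℝ) * f ^ m * Q ^ m * (th m (n-m) * Q ^ (n-m)) :=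
            mul_le_mul_of_nonneg_left (ih m (n-m)) (by positivity)
          _ = _ := by ring
      · have hm : n < m := by simp at hm; omega
        rw [Nat.descFactorial_of_lt hm]; simp
    refine (Finset.sum_le_sum fun m _ => e2 m).trans ?_
    rw [← Finset.sum_filter]
    calc _ ≤ ∑ m ∈ Finset.range (n+1), (n.choose m : ℝ) * f ^ m * th m (n-m) * Q ^ n := by
          refine Finset.sum_le_sum_of_subset_of_nonneg ?_ ?_
          · intro m hm; exact (Finset.mem_filter.mp hm).2
          · intro m _ _
            have := th_nonneg m (n-m)
            positivity
      _ = _ := by rw [← Finset.sum_mul, th_sum]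

end Wd

namespace Wd
variable {V : Type*}

/-- joint cumulants -/
def KK (M : Wd V) : Wd V := fun C => match C with
  | [] => 0
  | j :: C => RR M [j] C

theorem dl_KK (M : Wd V) (j : V) : dl j (KK M) = RR M [j] := rfl

theorem KK_mem {M : Wd V} (h1 : M [] = 1) (hM : M ∈ Sy V) : KK M ∈ Sy V := by
  intro C C' h
  induction h with
  | nil => rfl
  | cons j h ih => exact RR_mem hM [j] _ _ h
  | swap j l C =>
    change dl j (RR M [l]) C = dl l (RR M [j]) C
    rw [dl_RR h1, dl_RR h1, mul_comm (RR M [j])]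
    have : RR M ([l] ++ [j]) = RR M ([j] ++ [l]) := by
      unfold RR
      congr 1
      ext D
      exact hM _ _ (List.Perm.swap _ _ _)
    rw [this]
  | trans h1 h2 ih1 ih2 => rw [ih1, ih2]

theorem dl_M {M : Wd V} (h1 : M [] = 1) (j : V) : dl j M = dl j (KK M) * M := by
  rw [dl_KK, RR, mul_assoc, mul_comm (inv M), mul_inv M h1, mul_one]; rfl

section
variable [DecidableEq V]

theorem zz_mul {f : Wd V} (hf : f ∈ Sy V) (w : V) (C : List V) :
    (zz w * f) C = C.count w * f (C.erase w) := by
  induction C generalizing f with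
  | nil => simp [mul_nil, zz]
  | cons j C ih =>
    have hd : dl j f ∈ Sy V := fun C C' h => hf _ _ (h.cons j)
    rw [mul_cons, dl_zz, cst_mul, ih hd]
    by_cases hjw : j = w
    · subst hjw
      simp only [if_true, one_mul, List.count_cons_self, List.erase_cons_head]
      by_cases hm : j ∈ C
      · have : dl j f (C.erase j) = f C := hf _ _ (List.perm_cons_erase hm).symm
        rw [this]; push_cast; ring
      · rw [List.count_eq_zero_of_not_mem hm]; simp
    · rw [if_neg hjw, zero_mul, zero_add, List.count_cons_of_ne hjw, List.erase_cons_tail (by simpa using hjw)]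
      rfl

theorem wt_le (ξ : V → ℝ) (hξ : ∀ v, 0 ≤ ξ v) (C : List V) (r : ℕ) (hr : C.length = r) (h0 : 0 < r) :
    wt ξ C ≤ (∑ w ∈ C.toFinset, (C.count w : ℝ) * ξ w ^ r) / r := by
  have hr0 : (r : ℝ) ≠ 0 := by positivity
  have h := Real.geom_mean_le_arith_mean_weighted C.toFinset (fun w => (C.count w : ℝ) / r)
    (fun w => ξ w ^ r) (fun w _ => by positivity) ?_ (fun w _ => pow_nonneg (hξ w) r)
  · rw [wt, Finset.prod_list_map_count, Finset.sum_div]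
    refine le_trans (le_of_eq ?_) (h.trans (le_of_eq ?_))
    · refine Finset.prod_congr rfl fun w _ => ?_
      rw [← Real.rpow_natCast (ξ w) r, ← Real.rpow_mul (hξ w), mul_div_cancel₀ _ hr0, Real.rpow_natCast]
    · refine Finset.sum_congr rfl fun w _ => ?_
      ring
  · rw [← Finset.sum_div, ← Nat.cast_sum, List.sum_toFinset_count_eq_length, hr, div_self hr0]

variable [Fintype V] (nb : V → Finset V)

theorem KK_bound {M : Wd V} (hM : M [] = 1) (hS : M ∈ Sy V)
    (hfac : ∀ F C : List V, (∀ v ∈ F, ∀ j ∈ C, j ∉ nb v) → M (F ++ C) = M F * M C)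
    (ξ : V → ℝ) (hξ : ∀ v, 0 ≤ ξ v) (n : ℕ)
    (hb : ∀ C : List V, C.length ≤ n + 1 → |M C| ≤ wt ξ C) (C : List V) (hC : C.length = n + 1) :
    |KK M C| ≤ (∑ w : V, cst (2 ^ n / (n+1 : ℝ) * ξ w ^ (n+1)) * (zz w * uu nb n w) : Wd V) C := by
  rw [sum_ap]
  simp_rw [cst_mul, zz_mul (uu_mem nb n _)]
  have hw : ∀ w ∈ C, |KK M C| ≤ 2 ^ n * wt ξ C * uu nb n w (C.erase w) := by
    intro w hw
    have hp := List.perm_cons_erase hw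
    have hl : (C.erase w).length = n := by rw [List.length_erase_of_mem hw]; omega
    rw [KK_mem hM hS _ _ hp, wt_perm hp]
    have h := RR_bound nb hM hS hfac ξ hξ (n+1) hb n [w] (C.erase w) hl.le (by simp [hl]; omega)
    have e1 : PP nb n [w] = uu nb n w := by simp [PP]
    have e2 : wt ξ [w] = ξ w := by simp [wt]
    have e3 : wt (fun v => 2 * ξ v) (C.erase w) = 2 ^ n * wt ξ (C.erase w) := by
      simp only [wt]
      rw [List.prod_map_mul]; simp [hl]
    have e4 : wt ξ (w :: C.erase w) = ξ w * wt ξ (C.erase w) := by simp [wt]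
    rw [e1, e2, e3] at h
    rw [e4]
    refine h.trans (le_of_eq ?_)
    ring
  have hne : C.toFinset.Nonempty := by
    rw [List.toFinset_nonempty_iff]; rintro rfl; simp at hC
  obtain ⟨w0, hw0, hmin⟩ := Finset.exists_min_image C.toFinset (fun w => uu nb n w (C.erase w)) hne
  have hu0 : 0 ≤ uu nb n w0 (C.erase w0) := uu_nonneg nb n w0 _
  calc |KK M C| ≤ 2 ^ n * wt ξ C * uu nb n w0 (C.erase w0) := hw w0 (by simpa using hw0)
    _ ≤ 2 ^ n * ((∑ w ∈ C.toFinset, (C.count w : ℝ) * ξ w ^ (n+1)) / (n+1 : ℕ)) *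
        uu nb n w0 (C.erase w0) := by
        refine mul_le_mul_of_nonneg_right (mul_le_mul_of_nonneg_left ?_ (by positivity)) hu0
        exact wt_le ξ hξ C (n+1) hC (by omega)
    _ = ∑ w ∈ C.toFinset, 2 ^ n / (n+1 : ℝ) * ξ w ^ (n+1) *
          (C.count w * uu nb n w0 (C.erase w0)) := by
        rw [mul_div_assoc', Finset.mul_sum, Finset.sum_div, Finset.sum_mul]
        refine Finset.sum_congr rfl fun w _ => ?_
        push_cast; ring
    _ ≤ ∑ w ∈ C.toFinset, 2 ^ n / (n+1 : ℝ) * ξ w ^ (n+1) *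
          (C.count w * uu nb n w (C.erase w)) := by
        refine Finset.sum_le_sum fun w hw => ?_
        have := hξ w
        exact mul_le_mul_of_nonneg_left (mul_le_mul_of_nonneg_left (hmin w hw) (by positivity))
          (by positivity)
    _ ≤ _ := by
        refine Finset.sum_le_sum_of_subset_of_nonneg (Finset.subset_univ _) fun w _ _ => ?_
        have := hξ w
        have := uu_nonneg nb n w (C.erase w)
        exact mul_nonneg (by positivity) (mul_nonneg (by positivity) this)

theorem kap_bound {M : Wd V} (hM : M [] = 1) (hS : M ∈ Sy V)
    (hfac : ∀ F C : List V, (∀ v ∈ F, ∀ j ∈ C, j ∉ nb v) → M (F ++ C) = M F * M C)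
    (Q : ℕ) (hQ : ∀ v, (nb v).card ≤ Q)
    (ξ : V → ℝ) (hξ : ∀ v, 0 ≤ ξ v) (n : ℕ) (hn : 1 ≤ n)
    (hb : ∀ C : List V, C.length ≤ n + 1 → |M C| ≤ wt ξ C) :
    |ev (tau (KK M)) (n+1)| ≤ 2 ^ n * (n+1 : ℝ) ^ (n-1) * (Q:ℝ) ^ n * ∑ w, ξ w ^ (n+1) := by
  refine (tau_abs_le _ _ _ fun C hC => KK_bound nb hM hS hfac ξ hξ n hb C (by simpa using hC)).trans ?_
  have e : tau (∑ w : V, cst (2 ^ n / (n+1 : ℝ) * ξ w ^ (n+1)) * (zz w * uu nb n w) : Wd V) =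
      ∑ w : V, cst (2 ^ n / (n+1 : ℝ) * ξ w ^ (n+1)) * (zz () * tau (uu nb n w)) := by
    rw [map_sum]
    refine Finset.sum_congr rfl fun w _ => ?_
    rw [map_mul, map_mul, tau_zz, tau_cst]
  rw [e, sum_ap, Finset.mul_sum]
  refine Finset.sum_le_sum fun w _ => ?_
  have h1 : ev (tau (uu nb n w)) n ≤ (n+1 : ℝ) ^ (n-1) * (Q:ℝ) ^ n := by
    have h := aa_bound (Q := (Q:ℝ)) (by positivity) n 1 n
    rw [pow_one] at h
    refine (ev_mono (tau_uu nb Q hQ n w) n).trans (h.trans (le_of_eq ?_))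
    rw [th, if_neg (by omega)]; push_cast; rw [one_mul, add_comm (1:ℝ)]
  change ev (cst _ * _) (n+1) ≤ _
  rw [ev_cst_mul, ev_z_mul, Nat.add_sub_cancel]
  have hx := hξ w
  calc _ = 2 ^ n * ξ w ^ (n+1) * ev (tau (uu nb n w)) n := by push_cast; field_simp
    _ ≤ 2 ^ n * ξ w ^ (n+1) * ((n+1 : ℝ) ^ (n-1) * (Q:ℝ) ^ n) :=
      mul_le_mul_of_nonneg_left h1 (by positivity)
    _ = _ := by ring

end

theorem ev_mul (p q : Wd Unit) (n : ℕ) :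
    ev (p * q) n = ∑ x ∈ Finset.HasAntidiagonal.antidiagonal n,
      (n.choose x.1 : ℝ) * (ev p x.1 * ev q x.2) := by
  induction n generalizing p q with
  | zero => simp [ev, mul_nil]
  | succ n ih =>
    rw [Finset.sum_antidiagonal_choose_succ_mul (fun i j => ev p i * ev q j), ev_succ, dl_mul]
    have : ev (dl () p * q + p * dl () q) n = ev (dl () p * q) n + ev (p * dl () q) n := rfl
    rw [this, ih, ih, add_comm]
    simp only [ev_succ]
    congr 1
    refine Finset.sum_congr rfl fun x hx => ?_
    have hs : n.choose x.1 = n.choose x.2 := by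
      have := Finset.HasAntidiagonal.mem_antidiagonal.mp hx
      exact Nat.choose_symm_of_eq_add (by omega)
    rw [hs]

theorem kap_rec [Fintype V] {M : Wd V} (h1 : M [] = 1) (n : ℕ) :
    ev (tau M) (n+1) = ∑ x ∈ Finset.HasAntidiagonal.antidiagonal n,
      (n.choose x.1 : ℝ) * (ev (tau (KK M)) (x.1 + 1) * ev (tau M) x.2) := by
  have : dl () (tau M) = dl () (tau (KK M)) * tau M := by
    rw [dl_tau, dl_tau, Finset.sum_mul]
    refine Finset.sum_congr rfl fun v _ => ?_
    rw [dl_M h1, map_mul]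
  rw [ev_succ, this, ev_mul]
  rfl

end Wd

namespace Wd
section mom
variable {Ω V : Type*} [MeasurableSpace Ω] (μ : Measure Ω) [IsProbabilityMeasure μ]
  (X : V → Ω → ℝ)

/-- product of variables along a word -/
def pX (l : List V) (ω : Ω) : ℝ := (l.map (fun k => X k ω)).prod

/-- joint moments -/
def Mo : Wd V := fun l => ∫ ω, pX X l ω ∂μ

theorem pX_cons (j : V) (l : List V) (ω : Ω) : pX X (j :: l) ω = X j ω * pX X l ω := by simp [pX]
theorem pX_append (l l' : List V) (ω : Ω) : pX X (l ++ l') ω = pX X l ω * pX X l' ω := by simp [pX]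

theorem Mo_nil : Mo μ X [] = 1 := by simp [Mo, pX]

theorem Mo_mem : Mo μ X ∈ Sy V := by
  intro C C' h
  unfold Mo
  congr 1
  ext ω
  exact (h.map _).prod_eq

variable {X}
theorem pX_meas (hX : ∀ k, Measurable (X k)) (l : List V) : Measurable (pX X l) := by
  induction l with
  | nil => exact measurable_const (a := (1:ℝ))
  | cons j l ih =>
    have : pX X (j :: l) = fun ω => X j ω * pX X l ω := by ext ω; exact pX_cons X j l ω
    rw [this]; exact (hX j).mul ih

variable {μ}

theorem pX_bound (hX : ∀ k, Measurable (X k))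
    {L : ℝ} (hL : 0 ≤ L) (hb : ∀ k, ∀ᵐ ω ∂μ, |X k ω| ≤ L) (l : List V) : ∀ᵐ ω ∂μ, |pX X l ω| ≤ L ^ l.length := by
  induction l with
  | nil => simp [pX]
  | cons j l ih =>
    filter_upwards [ih, hb j] with ω h1 h2
    rw [pX_cons, abs_mul, List.length_cons, pow_succ']
    exact mul_le_mul h2 h1 (abs_nonneg _) hL

theorem pX_int (hX : ∀ k, Measurable (X k))
    {L : ℝ} (hL : 0 ≤ L) (hb : ∀ k, ∀ᵐ ω ∂μ, |X k ω| ≤ L) (l : List V) : Integrable (pX X l) μ :=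
  Integrable.of_bound (pX_meas hX l).aestronglyMeasurable _ (pX_bound hX hL hb l)

theorem absX_int (hX : ∀ k, Measurable (X k))
    {L : ℝ} (hL : 0 ≤ L) (hb : ∀ k, ∀ᵐ ω ∂μ, |X k ω| ≤ L) (k : V) (r : ℕ) : Integrable (fun ω => |X k ω| ^ r) μ := by
  refine Integrable.of_bound ((hX k).norm.pow_const r).aestronglyMeasurable (L ^ r) ?_
  filter_upwards [hb k] with ω h
  rw [Real.norm_eq_abs, abs_of_nonneg (by positivity)]
  exact pow_le_pow_left₀ (abs_nonneg _) h r

theorem S_bound (hX : ∀ k, Measurable (X k))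
    {L : ℝ} (hL : 0 ≤ L) (hb : ∀ k, ∀ᵐ ω ∂μ, |X k ω| ≤ L) [Fintype V] : ∀ᵐ ω ∂μ, |∑ k, X k ω| ≤ Fintype.card V * L := by
  have := ae_all_iff.mpr hb
  filter_upwards [this] with ω h
  refine (Finset.abs_sum_le_sum_abs _ _).trans ?_
  refine (Finset.sum_le_sum fun k _ => h k).trans ?_
  simp

theorem pXS_int (hX : ∀ k, Measurable (X k))
    {L : ℝ} (hL : 0 ≤ L) (hb : ∀ k, ∀ᵐ ω ∂μ, |X k ω| ≤ L) [Fintype V] (l : List V) (n : ℕ) :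
    Integrable (fun ω => pX X l ω * (∑ k, X k ω) ^ n) μ := by
  refine Integrable.of_bound (((pX_meas hX l).mul
    ((Finset.measurable_sum _ fun k _ => hX k).pow_const n)).aestronglyMeasurable)
      (L ^ l.length * (Fintype.card V * L) ^ n) ?_
  filter_upwards [pX_bound hX hL hb l, S_bound hX hL hb] with ω h1 h2
  rw [Real.norm_eq_abs, abs_mul, abs_pow]
  exact mul_le_mul h1 (pow_le_pow_left₀ (abs_nonneg _) h2 n) (by positivity) (by positivity)

theorem tau_Mo (hX : ∀ k, Measurable (X k))
    {L : ℝ} (hL : 0 ≤ L) (hb : ∀ k, ∀ᵐ ω ∂μ, |X k ω| ≤ L) [Fintype V] (n : ℕ) (l : List V) :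
    ev (tau (sh l (Mo μ X))) n = ∫ ω, pX X l ω * (∑ k, X k ω) ^ n ∂μ := by
  induction n generalizing l with
  | zero =>
    change (sh l (Mo μ X)) [] = _
    simp [sh, Mo]
  | succ n ih =>
    rw [ev_succ, dl_tau]
    have : ev (∑ v : V, tau (dl v (sh l (Mo μ X)))) n = ∑ v : V, ev (tau (dl v (sh l (Mo μ X)))) n :=
      sum_ap _ _ _
    rw [this]
    simp_rw [dl_sh, ih]
    rw [← integral_finsetSum _ (fun v _ => pXS_int hX hL hb _ _)]
    congr 1
    ext ω
    simp_rw [pX_append]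
    rw [← Finset.sum_mul, ← Finset.mul_sum, pow_succ']
    simp [pX]; ring

/-- Hölder -/
theorem Mo_bound (hX : ∀ k, Measurable (X k))
    {L : ℝ} (hL : 0 ≤ L) (hb : ∀ k, ∀ᵐ ω ∂μ, |X k ω| ≤ L) [DecidableEq V] (r : ℕ) (hr : 0 < r) (ξ : V → ℝ) (hξ0 : ∀ v, 0 ≤ ξ v)
    (hξ : ∀ v, ξ v ^ r = ∫ ω, |X v ω| ^ r ∂μ) (C : List V) (hC : C.length ≤ r) :
    |Mo μ X C| ≤ wt ξ C := by
  have hr0 : (r:ℝ) ≠ 0 := by positivity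
  by_cases hz : ∃ w ∈ C, ξ w = 0
  · obtain ⟨w, hw, hw0⟩ := hz
    have h0 : ∫ ω, |X w ω| ^ r ∂μ = 0 := by rw [← hξ, hw0, zero_pow hr.ne']
    rw [integral_eq_zero_iff_of_nonneg (fun ω => by positivity) (absX_int hX hL hb w r)] at h0
    have : Mo μ X C = 0 := by
      unfold Mo
      rw [integral_eq_zero_of_ae]
      filter_upwards [h0] with ω h
      have h : X w ω = 0 := by
        have : |X w ω| ^ r = 0 := h
        simpa [hr.ne'] using this
      simp only [pX, Pi.zero_apply]
      exact List.prod_eq_zero (List.mem_map.mpr ⟨w, hw, h⟩)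
    rw [this, abs_zero]
    exact wt_nonneg hξ0 C
  push Not at hz
  have hpos : ∀ w ∈ C.toFinset, 0 < ξ w := fun w hw =>
    lt_of_le_of_ne (hξ0 w) (Ne.symm (hz w (by simpa using hw)))
  have hcount : ∑ w ∈ C.toFinset, (C.count w : ℝ) / r = C.length / r := by
    rw [← Finset.sum_div, ← Nat.cast_sum, List.sum_toFinset_count_eq_length]
  have hpt : ∀ ω, |pX X C ω| ≤ wt ξ C * (∑ w ∈ C.toFinset, (C.count w : ℝ) / r *
      (|X w ω| ^ r / ξ w ^ r) + (1 - C.length / r)) := by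
    intro ω
    have h := Real.geom_mean_le_arith_mean_weighted (Finset.insertNone C.toFinset)
      (fun o => o.elim (1 - (C.length:ℝ) / r) (fun w => (C.count w : ℝ) / r))
      (fun o => o.elim 1 (fun w => |X w ω| ^ r / ξ w ^ r)) ?_ ?_ ?_
    · rw [Finset.prod_insertNone, Finset.sum_insertNone] at h
      simp only [Option.elim_none, Option.elim_some, Real.one_rpow, one_mul, mul_one] at h
      have e : |pX X C ω| = wt ξ C * ∏ w ∈ C.toFinset, (|X w ω| ^ r / ξ w ^ r) ^ ((C.count w : ℝ) / r) := by
        have e1 : |pX X C ω| = (C.map (fun k => |X k ω|)).prod := by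
          have : ∀ A : List V, |pX X A ω| = (A.map (fun k => |X k ω|)).prod := by
            intro A
            induction A with
            | nil => simp [pX]
            | cons j A ih => rw [pX_cons, abs_mul, ih]; simp
          exact this C
        rw [e1, wt, Finset.prod_list_map_count, Finset.prod_list_map_count, ← Finset.prod_mul_distrib]
        refine Finset.prod_congr rfl fun w hw => ?_
        have hp := hpos w hw
        rw [← div_pow, ← Real.rpow_natCast (|X w ω| / ξ w) r, ← Real.rpow_mul (by positivity),
          mul_div_cancel₀ _ hr0, Real.rpow_natCast, ← mul_pow, mul_div_cancel₀ _ hp.ne']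
      rw [e]
      refine mul_le_mul_of_nonneg_left ?_ (wt_nonneg hξ0 C)
      linarith
    · intro o _
      cases o with
      | none =>
        simp only [Option.elim_none, sub_nonneg]
        rw [div_le_one (by positivity)]
        exact_mod_cast hC
      | some w => simp only [Option.elim_some]; positivity
    · rw [Finset.sum_insertNone]
      simp only [Option.elim_none, Option.elim_some]
      rw [hcount]; ring
    · intro o ho
      cases o with
      | none => simp
      | some w =>
        simp only [Option.elim_some]
        have := hξ0 w
        positivity
  have hIntg : ∀ w, Integrable (fun ω => (C.count w : ℝ) / r * (|X w ω| ^ r / ξ w ^ r)) μ :=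
    fun w => ((absX_int hX hL hb w r).div_const _).const_mul _
  calc |Mo μ X C| ≤ ∫ ω, |pX X C ω| ∂μ := abs_integral_le_integral_abs
    _ ≤ ∫ ω, wt ξ C * (∑ w ∈ C.toFinset, (C.count w : ℝ) / r *
      (|X w ω| ^ r / ξ w ^ r) + (1 - C.length / r)) ∂μ := by
        refine integral_mono (pX_int hX hL hb C).abs ?_ hpt
        exact ((integrable_finsetSum _ fun w _ => hIntg w).add (integrable_const _)).const_mul _
    _ = wt ξ C * (∑ w ∈ C.toFinset, (C.count w : ℝ) / r * (ξ w ^ r / ξ w ^ r) + (1 - C.length / r)) := by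
        rw [integral_const_mul, integral_add (integrable_finsetSum _ fun w _ => hIntg w)
          (integrable_const _), integral_finsetSum _ (fun w _ => hIntg w)]
        simp_rw [integral_const_mul, integral_div, ← hξ]
        simp
    _ = wt ξ C := by
        have : ∑ w ∈ C.toFinset, (C.count w : ℝ) / r * (ξ w ^ r / ξ w ^ r) = C.length / r := by
          rw [← hcount]
          refine Finset.sum_congr rfl fun w hw => ?_
          rw [div_self (pow_pos (hpos w hw) r).ne', mul_one]
        rw [this]; ring

end mom

theorem Mo_fac {Ω V : Type*} [MeasurableSpace Ω] (μ : Measure Ω) [IsProbabilityMeasure μ]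
    (Y : V → Ω → ℝ) (hY : ∀ k, Measurable (Y k)) (c : V → ℝ) (G : SimpleGraph V)
    (hG : IsDependencyGraph μ G Y) (F C : List V)
    (h : ∀ v ∈ F, ∀ j ∈ C, j ≠ v ∧ ¬ G.Adj v j) :
    Mo μ (fun k ω => Y k ω - c k) (F ++ C) =
      Mo μ (fun k ω => Y k ω - c k) F * Mo μ (fun k ω => Y k ω - c k) C := by
  classical
  have hi := hG {v | v ∈ F} {j | j ∈ C} (by
    rw [Set.disjoint_left]
    intro a ha hb
    exact (h a ha a hb).1 rfl) (fun i hi j hj => (h i hi j hj).2)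
  let g : ∀ (A : List V), ({v | v ∈ A} → ℝ) → ℝ := fun A y =>
    (A.map (fun k => if hk : k ∈ {v | v ∈ A} then y ⟨k, hk⟩ - c k else 0)).prod
  have hg : ∀ A, Measurable (g A) := by
    intro A
    have : ∀ B : List V, Measurable (fun y : ({v | v ∈ A} → ℝ) =>
      (B.map (fun k => if hk : k ∈ {v | v ∈ A} then y ⟨k, hk⟩ - c k else 0)).prod) := by
      intro B
      induction B with
      | nil => simp
      | cons b B ih =>
        simp only [List.map_cons, List.prod_cons]
        refine Measurable.mul ?_ ih
        by_cases hb : b ∈ {v | v ∈ A}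
        · simp only [hb, dif_pos]
          exact (measurable_pi_apply _).sub_const _
        · simp only [hb, dif_neg, not_false_iff]
          exact measurable_const
    exact this A
  have e : ∀ A ω, g A (fun i : {v | v ∈ A} => Y i.1 ω) = pX (fun k ω => Y k ω - c k) A ω := by
    intro A ω
    simp only [g, pX]
    congr 1
    refine List.map_congr_left fun k hk => ?_
    exact dif_pos hk
  have hi2 := hi.comp (hg F) (hg C)
  have h1 : (g F ∘ fun ω (i : {v | v ∈ F}) => Y i.1 ω) = pX (fun k ω => Y k ω - c k) F := by
    ext ω; exact e F ω
  have h2 : (g C ∘ fun ω (i : {v | v ∈ C}) => Y i.1 ω) = pX (fun k ω => Y k ω - c k) C := by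
    ext ω; exact e C ω
  rw [h1, h2] at hi2
  have hm : ∀ k, Measurable (fun ω => Y k ω - c k) := fun k => (hY k).sub_const _
  have := hi2.integral_fun_mul_eq_mul_integral (pX_meas (X := fun k ω => Y k ω - c k) hm F).aestronglyMeasurable
    (pX_meas (X := fun k ω => Y k ω - c k) hm C).aestronglyMeasurable
  unfold Mo
  rw [← this]
  congr 1
  ext ω
  exact pX_append _ F C ω

end Wd

/-- Existence of cumulants with good bounds. -/
theorem cumulants {Ω V : Type*} [MeasurableSpace Ω] [Fintype V]
    (μ : Measure Ω) [IsProbabilityMeasure μ]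
    (Y : V → Ω → ℝ) (hYmeas : ∀ k, Measurable (Y k))
    (G : SimpleGraph V) [DecidableRel G.Adj]
    (hG : IsDependencyGraph μ G Y)
    (D : ℕ) (hD : ∀ k, G.degree k ≤ D)
    (c : V → ℝ)
    (L : ℝ) (hL : 0 ≤ L)
    (hbdd : ∀ k, ∀ᵐ ω ∂μ, |Y k ω - c k| ≤ L) :
    ∃ κ : ℕ → ℝ,
      (∀ n : ℕ, ∫ ω, (∑ k, (Y k ω - c k)) ^ (n+1) ∂μ = ∑ x ∈ Finset.HasAntidiagonal.antidiagonal n,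
        (n.choose x.1 : ℝ) * (κ (x.1 + 1) * ∫ ω, (∑ k, (Y k ω - c k)) ^ x.2 ∂μ)) ∧
      ∀ n : ℕ, 1 ≤ n → |κ (n+1)| ≤ 2 ^ n * (n+1 : ℝ) ^ (n-1) * (D+1 : ℝ) ^ n *
        ∑ k, ∫ ω, |Y k ω - c k| ^ (n+1) ∂μ := by
  classical
  have hm : ∀ k, Measurable (fun ω => Y k ω - c k) := fun k => (hYmeas k).sub_const _
  set M := Wd.Mo μ (fun k ω => Y k ω - c k) with hM
  have hev : ∀ n, Wd.ev (Wd.tau M) n = ∫ ω, (∑ k, (Y k ω - c k)) ^ n ∂μ := by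
    intro n
    have := Wd.tau_Mo (X := fun k ω => Y k ω - c k) hm hL hbdd n []
    have e : Wd.sh [] (Wd.Mo μ (fun k ω => Y k ω - c k)) = M := rfl
    rw [e] at this
    simpa [Wd.pX] using this
  refine ⟨Wd.ev (Wd.tau (Wd.KK M)), ?_, ?_⟩
  · intro n
    have := Wd.kap_rec (M := M) (Wd.Mo_nil μ _) n
    simpa only [hev] using this
  · intro n hn
    have hint0 : ∀ k, 0 ≤ ∫ ω, |Y k ω - c k| ^ (n+1) ∂μ :=
      fun k => integral_nonneg fun ω => by positivity
    have hξ : ∀ k, ((∫ ω, |Y k ω - c k| ^ (n+1) ∂μ) ^ ((1:ℝ) / (n+1 : ℕ))) ^ (n+1) =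
        ∫ ω, |Y k ω - c k| ^ (n+1) ∂μ := by
      intro k
      rw [← Real.rpow_natCast, ← Real.rpow_mul (hint0 k), one_div_mul_cancel (by positivity),
        Real.rpow_one]
    have h := Wd.kap_bound (fun v => insert v (G.neighborFinset v)) (M := M) (Wd.Mo_nil μ _)
      (Wd.Mo_mem μ _) ?_ (D+1) ?_
      (fun k => (∫ ω, |Y k ω - c k| ^ (n+1) ∂μ) ^ ((1:ℝ) / (n+1 : ℕ)))
      (fun k => Real.rpow_nonneg (hint0 k) _) n hn ?_
    · simp only [hξ] at h
      simpa only [Nat.cast_add, Nat.cast_one] using h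
    · intro F C h
      refine Wd.Mo_fac μ Y hYmeas c G hG F C fun v hv j hj => ?_
      have := h v hv j hj
      simpa [not_or] using this
    · intro v
      exact (Finset.card_insert_le _ _).trans (Nat.succ_le_succ (hD v))
    · intro C hC
      exact Wd.Mo_bound (X := fun k ω => Y k ω - c k) hm hL hbdd (n+1) (by omega) _
        (fun k => Real.rpow_nonneg (hint0 k) _) hξ C hC


theorem egf_deriv (c : ℕ → ℝ) (x0 : ℝ) (hx0 : 0 < x0)
    (hs : Summable fun n : ℕ => |c (n+1)| * x0 ^ n / n.factorial) (x : ℂ) (hx : ‖x‖ < x0) :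
    HasDerivAt (fun y : ℂ => ∑' n : ℕ, (c (n+1) : ℂ) * y ^ (n+1) / (n+1).factorial)
      (∑' n : ℕ, (c (n+1) : ℂ) * x ^ n / n.factorial) x := by
  refine hasDerivAt_tsum_of_isPreconnected (t := Metric.ball (0:ℂ) x0) (y₀ := 0)
    (g := fun n y => (c (n+1) : ℂ) * y ^ (n+1) / (n+1).factorial)
    (g' := fun n y => (c (n+1) : ℂ) * y ^ n / n.factorial) hs Metric.isOpen_ball
    (convex_ball (0:ℂ) x0).isPreconnected ?_ ?_ ?_ ?_ ?_
  · intro n y _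
    have h := ((hasDerivAt_pow (n+1) y).const_mul (c (n+1) : ℂ)).div_const ((n+1).factorial : ℂ)
    refine h.congr_deriv ?_
    rw [Nat.factorial_succ]
    have : (n.factorial : ℂ) ≠ 0 := by exact_mod_cast n.factorial_ne_zero
    have : ((n:ℂ) + 1) ≠ 0 := by exact_mod_cast n.succ_ne_zero
    push_cast
    field_simp
  · intro n y hy
    have hy : ‖y‖ < x0 := by simpa using hy
    rw [norm_div, norm_mul, norm_pow, Complex.norm_real, Complex.norm_natCast, Real.norm_eq_abs]
    gcongr
  · simpa using hx0
  · simpa using summable_zero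
  · simpa using hx

theorem egf_summable (c : ℕ → ℝ) (x0 : ℝ)
    (hs : Summable fun n : ℕ => |c (n+1)| * x0 ^ n / n.factorial) (x : ℂ) (hx : ‖x‖ < x0) :
    Summable fun n : ℕ => ‖(c (n+1) : ℂ) * x ^ n / n.factorial‖ := by
  refine Summable.of_nonneg_of_le (fun n => norm_nonneg _) (fun n => ?_) hs
  rw [norm_div, norm_mul, norm_pow, Complex.norm_real, Complex.norm_natCast, Real.norm_eq_abs]
  gcongr

theorem egf_exp (m κ : ℕ → ℝ) (h0 : m 0 = 1)
    (hrec : ∀ n, m (n+1) = ∑ x ∈ Finset.HasAntidiagonal.antidiagonal n,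
        (n.choose x.1 : ℝ) * (κ (x.1 + 1) * m x.2))
    (x0 : ℝ) (hx0 : 0 < x0)
    (hκ : Summable fun n : ℕ => |κ (n+1)| * x0 ^ n / n.factorial)
    (R : ℝ) (hm : ∀ n, |m n| ≤ R ^ n) (hR : 0 ≤ R) (x : ℂ) (hx : ‖x‖ < x0) :
    ∑' n : ℕ, (m n : ℂ) * x ^ n / n.factorial =
      Complex.exp (∑' n : ℕ, (κ (n+1) : ℂ) * x ^ (n+1) / (n+1).factorial) := by
  have hms : Summable fun n : ℕ => |m (n+1)| * x0 ^ n / n.factorial := by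
    refine Summable.of_nonneg_of_le (fun n => by positivity) (fun n => ?_)
      ((Real.summable_pow_div_factorial (R * x0)).mul_left R)
    calc |m (n+1)| * x0 ^ n / n.factorial ≤ R ^ (n+1) * x0 ^ n / n.factorial := by
          gcongr; exact hm _
      _ = _ := by rw [mul_pow]; ring
  have hms2 : ∀ y : ℂ, Summable fun n : ℕ => ‖(m n : ℂ) * y ^ n / n.factorial‖ := by
    intro y
    refine Summable.of_nonneg_of_le (fun n => norm_nonneg _) (fun n => ?_)
      ((Real.summable_pow_div_factorial (R * ‖y‖)))
    rw [norm_div, norm_mul, norm_pow, Complex.norm_real, Complex.norm_natCast, Real.norm_eq_abs,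
      mul_pow]
    gcongr; exact hm _
  have hsplit : ∀ y : ℂ, ∑' n : ℕ, (m n : ℂ) * y ^ n / n.factorial =
      1 + ∑' n : ℕ, (m (n+1) : ℂ) * y ^ (n+1) / (n+1).factorial := by
    intro y
    rw [(hms2 y).of_norm.tsum_eq_zero_add]
    simp [h0]
  set GK : ℂ → ℂ := fun y => ∑' n : ℕ, (κ (n+1) : ℂ) * y ^ (n+1) / (n+1).factorial with hGK
  set GM : ℂ → ℂ := fun y => ∑' n : ℕ, (m (n+1) : ℂ) * y ^ (n+1) / (n+1).factorial with hGM
  have hd : ∀ y ∈ Metric.ball (0:ℂ) x0,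
      HasDerivAt (fun y => (1 + GM y) * Complex.exp (-GK y)) 0 y := by
    intro y hy
    have hy : ‖y‖ < x0 := by simpa using hy
    have d1 := egf_deriv κ x0 hx0 hκ y hy
    have d2 := egf_deriv m x0 hx0 hms y hy
    have h := (d2.const_add 1).mul d1.neg.cexp
    refine HasDerivAt.congr_deriv h ?_
    have hprod : ∑' n : ℕ, (m (n+1) : ℂ) * y ^ n / n.factorial =
        (∑' n : ℕ, (κ (n+1) : ℂ) * y ^ n / n.factorial) * (1 + GM y) := by
      rw [← hsplit, tsum_mul_tsum_eq_tsum_sum_antidiagonal_of_summable_norm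
        (egf_summable κ x0 hκ y hy) (hms2 y)]
      refine tsum_congr fun n => ?_
      rw [hrec]
      push_cast
      rw [Finset.sum_mul, Finset.sum_div]
      refine Finset.sum_congr rfl fun p hp => ?_
      have hp := Finset.HasAntidiagonal.mem_antidiagonal.mp hp
      have hf := Nat.add_choose_mul_factorial_mul_factorial p.1 p.2
      have hs : n.choose p.1 = n.choose p.2 := Nat.choose_symm_of_eq_add (by omega)
      rw [hp, ← hs] at hf
      have h0 : (n.choose p.1 : ℂ) ≠ 0 := by
        exact_mod_cast (Nat.choose_pos (by omega)).ne'
      have h1 : (p.1.factorial : ℂ) ≠ 0 := by exact_mod_cast p.1.factorial_ne_zero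
      have h2 : (p.2.factorial : ℂ) ≠ 0 := by exact_mod_cast p.2.factorial_ne_zero
      rw [← hf]
      have : y ^ n = y ^ p.1 * y ^ p.2 := by rw [← pow_add, hp]
      rw [this]
      push_cast
      field_simp
    rw [hprod]
    simp only [hGK, hGM]
    ring
  have hconst := (convex_ball (0:ℂ) x0).is_const_of_fderivWithin_eq_zero (𝕜 := ℂ)
    (f := fun y => (1 + GM y) * Complex.exp (-GK y))
    (fun y hy => (hd y hy).differentiableAt.differentiableWithinAt) (fun y hy => by
      rw [fderivWithin_of_isOpen Metric.isOpen_ball hy]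
      ext; simp [(hd y hy).deriv]) (x := x) (y := 0) (by simpa using hx) (by simpa using hx0)
  have hGM0 : GM 0 = 0 := by simp [hGM]
  have hGK0 : GK 0 = 0 := by simp [hGK]
  simp only [hGM0, hGK0] at hconst
  rw [hsplit]
  rw [Complex.exp_neg] at hconst
  have := Complex.exp_ne_zero (GK x)
  field_simp at hconst
  simpa using hconst

theorem exp_moment {Ω : Type*} [MeasurableSpace Ω] (μ : Measure Ω) [IsProbabilityMeasure μ]
    (S : Ω → ℝ) (hS : Measurable S) (R : ℝ) (hR : 0 ≤ R) (hb : ∀ᵐ ω ∂μ, |S ω| ≤ R) (x : ℂ) :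
    ∫ ω, Complex.exp (x * S ω) ∂μ = ∑' n : ℕ, ((∫ ω, S ω ^ n ∂μ : ℝ) : ℂ) * x ^ n / n.factorial := by
  have hb2 : ∀ n : ℕ, ∀ᵐ ω ∂μ, ‖((S ω : ℂ)) ^ n * x ^ n / n.factorial‖ ≤
      (R * ‖x‖) ^ n / n.factorial := by
    intro n
    filter_upwards [hb] with ω h
    rw [norm_div, norm_mul, norm_pow, norm_pow, Complex.norm_real, Complex.norm_natCast,
      Real.norm_eq_abs, mul_pow]
    gcongr
  have hIntg : ∀ n : ℕ, Integrable (fun ω => ((S ω : ℂ)) ^ n * x ^ n / n.factorial) μ := by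
    intro n
    refine Integrable.of_bound ?_ _ (hb2 n)
    exact ((((Complex.measurable_ofReal.comp hS).pow_const n).mul_const _).div_const _).aestronglyMeasurable
  have h := hasSum_integral_of_summable_integral_norm hIntg ?_
  · have e : ∀ ω, ∑' n : ℕ, ((S ω : ℂ)) ^ n * x ^ n / n.factorial = Complex.exp (x * S ω) := by
      intro ω
      rw [Complex.exp_eq_exp_ℂ, NormedSpace.exp_eq_tsum_div]
      refine tsum_congr fun n => ?_
      rw [mul_pow, mul_comm]
    simp_rw [e] at h
    rw [← h.tsum_eq]
    refine tsum_congr fun n => ?_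
    rw [integral_div, integral_mul_const]
    congr 2
    rw [← integral_complex_ofReal]
    push_cast; rfl
  · refine Summable.of_nonneg_of_le (fun n => integral_nonneg fun _ => norm_nonneg _) (fun n => ?_)
      (Real.summable_pow_div_factorial (R * ‖x‖))
    calc _ ≤ ∫ ω, (R * ‖x‖) ^ n / n.factorial ∂μ :=
          integral_mono_ae (hIntg n).norm (integrable_const _) (hb2 n)
      _ = _ := by simp


/-- tail coefficients -/
def tt (k : ℕ) : ℝ := 2 ^ (k+3) * (k+4 : ℝ) ^ (k+2) / (k+4).factorial * (1 / (2 * Real.exp 1)) ^ k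

theorem tt_nonneg (k : ℕ) : 0 ≤ tt k := by
  unfold tt; have := Real.exp_pos 1; positivity

theorem tt_le (k : ℕ) : tt k ≤ 8 * Real.exp 1 ^ 4 / Real.sqrt (2 * Real.pi * (k+4 : ℝ)) / (k+4 : ℝ) ^ 2 := by
  have h := Stirling.le_factorial_stirling (k+4)
  have he := Real.exp_pos 1
  have hpi := Real.pi_pos
  push_cast at h
  have hs : 0 < Real.sqrt (2 * Real.pi * (k+4 : ℝ)) := Real.sqrt_pos.mpr (by positivity)
  have hlow : 0 < Real.sqrt (2 * Real.pi * (k+4 : ℝ)) * ((k+4 : ℝ) / Real.exp 1) ^ (k+4) := by positivity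
  unfold tt
  calc _ ≤ 2 ^ (k+3) * (k+4 : ℝ) ^ (k+2) / (Real.sqrt (2 * Real.pi * (k+4 : ℝ)) * ((k+4 : ℝ) / Real.exp 1) ^ (k+4)) * (1 / (2 * Real.exp 1)) ^ k := by
        gcongr
    _ = _ := by
        rw [div_pow, div_pow, one_pow, mul_pow]
        field_simp
        ring

theorem tt_summable : Summable fun k : ℕ => ((k:ℝ)+4) * tt k := by
  have h1 : Summable fun n : ℕ => 1 / (n:ℝ) ^ (3/2 : ℝ) :=
    Real.summable_one_div_nat_rpow.mpr (by norm_num)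
  have h2 := ((summable_nat_add_iff 4).mpr h1).mul_left (8 * Real.exp 1 ^ 4 / Real.sqrt (2 * Real.pi))
  refine Summable.of_nonneg_of_le (fun k => mul_nonneg (by positivity) (tt_nonneg k)) (fun k => ?_) h2
  have hk : (0:ℝ) < (k:ℝ) + 4 := by positivity
  have hpi := Real.pi_pos
  calc ((k:ℝ)+4) * tt k ≤ ((k:ℝ)+4) * (8 * Real.exp 1 ^ 4 / Real.sqrt (2 * Real.pi * (k+4 : ℝ)) / (k+4 : ℝ) ^ 2) :=
        mul_le_mul_of_nonneg_left (tt_le k) hk.le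
    _ = _ := by
      have : (((k+4 : ℕ) : ℝ)) ^ (3/2 : ℝ) = ((k:ℝ)+4) * Real.sqrt ((k:ℝ)+4) := by
        push_cast
        rw [show (3/2:ℝ) = 1 + 1/2 by norm_num, Real.rpow_add hk, Real.rpow_one, Real.sqrt_eq_rpow]
      rw [this, Real.sqrt_mul (by positivity)]
      have : 0 < Real.sqrt ((k:ℝ)+4) := Real.sqrt_pos.mpr hk
      have : 0 < Real.sqrt (2 * Real.pi) := Real.sqrt_pos.mpr (by positivity)
      field_simp

theorem tt_summable' : Summable tt := by
  refine Summable.of_nonneg_of_le tt_nonneg (fun k => ?_) tt_summable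
  have := tt_nonneg k
  nlinarith [show (0:ℝ) ≤ k by positivity]

theorem tt_sum : ∑' k, tt k ≤ 20 := by
  have he := Real.exp_pos 1
  have he1 : Real.exp 1 < 2.7182818286 := Real.exp_one_lt_d9
  have he2 : 2.7182818283 < Real.exp 1 := Real.exp_one_gt_d9
  have htail : ∀ k : ℕ, tt (k+4) ≤ 61.62 / ((k:ℝ)+8)^2 := by
    intro k
    refine (tt_le (k+4)).trans ?_
    push_cast
    have e : (k:ℝ) + 4 + 4 = k + 8 := by ring
    rw [e]
    gcongr
    have hs : 7.089 ≤ Real.sqrt (2 * Real.pi * (k+8 : ℝ)) := by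
      apply Real.le_sqrt_of_sq_le
      have := Real.pi_gt_d6
      nlinarith [show (0:ℝ) ≤ k by positivity]
    rw [div_le_iff₀ (by linarith)]
    have : Real.exp 1 ^ 4 ≤ 2.7182818286 ^ 4 := by gcongr
    calc 8 * Real.exp 1 ^ 4 ≤ 8 * 2.7182818286 ^ 4 := by gcongr
      _ ≤ 61.62 * 7.089 := by norm_num
      _ ≤ _ := by gcongr
  have hpart : ∀ n : ℕ, ∑ i ∈ Finset.range n, tt (i+4) ≤ 61.62 * (1/7.5 - 1/((n:ℝ)+7.5)) := by
    intro n
    induction n with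
    | zero => simp
    | succ n ih =>
      rw [Finset.sum_range_succ]
      have h1 := htail n
      have h2 : 61.62 / ((n:ℝ)+8)^2 ≤ 61.62 * (1/((n:ℝ)+7.5) - 1/((n:ℝ)+8.5)) := by
        rw [div_eq_mul_one_div]
        gcongr
        rw [div_sub_div _ _ (by positivity) (by positivity), div_le_div_iff₀ (by positivity) (by positivity)]
        nlinarith
      have h3 : ((n+1 : ℕ):ℝ) + 7.5 = n + 8.5 := by push_cast; ring
      rw [h3]
      linarith
  have hi : 1 / (2 * Real.exp 1) ≤ 0.18394 := by
    rw [div_le_iff₀ (by positivity)]; linarith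
  have hi0 : 0 ≤ 1 / (2 * Real.exp 1) := by positivity
  have hsum := tt_summable'.sum_add_tsum_nat_add 4
  rw [← hsum]
  have h4 : ∑' i, tt (i+4) ≤ 61.62/7.5 := by
    refine Real.tsum_le_of_sum_range_le (fun i => tt_nonneg _) fun n => (hpart n).trans ?_
    have : (0:ℝ) ≤ 1/((n:ℝ)+7.5) := by positivity
    linarith
  have h0 : tt 0 ≤ 5.3334 := by unfold tt; norm_num [Nat.factorial]
  have h1 : tt 1 ≤ 3.066 := by
    unfold tt
    have : (1 / (2 * Real.exp 1)) ^ 1 ≤ 0.18394 ^ 1 := by gcongr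
    norm_num [Nat.factorial] at this ⊢
    linarith
  have h2 : tt 2 ≤ 1.95 := by
    unfold tt
    have : (1 / (2 * Real.exp 1)) ^ 2 ≤ 0.18394 ^ 2 := by gcongr
    generalize (1 / (2 * Real.exp 1)) ^ 2 = z at *
    norm_num [Nat.factorial] at this ⊢
    linarith
  have h3 : tt 3 ≤ 1.33 := by
    unfold tt
    have : (1 / (2 * Real.exp 1)) ^ 3 ≤ 0.18394 ^ 3 := by gcongr
    generalize (1 / (2 * Real.exp 1)) ^ 3 = z at *
    norm_num [Nat.factorial] at this ⊢
    linarith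
  simp only [Finset.sum_range_succ, Finset.sum_range_zero]
  norm_num at *
  linarith


theorem kap_term (κ : ℕ → ℝ) (Q L A : ℝ) (hQ : 0 < Q) (hL : 0 < L) (hA : 0 ≤ A)
    (hκ : ∀ k : ℕ, |κ (k+4)| ≤ 2 ^ (k+3) * (k+4 : ℝ) ^ (k+2) * Q ^ (k+3) * (L ^ k * A))
    (y : ℝ) (hy : 0 ≤ y) (hy1 : y ≤ 1 / (2 * Real.exp 1 * (Q * L))) (k : ℕ) :
    |κ (k+4)| * y ^ (k+4) / (k+4).factorial ≤ Q ^ 3 * A * y ^ 4 * tt k := by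
  have he := Real.exp_pos 1
  have h1 : Q * L * y ≤ 1 / (2 * Real.exp 1) := by
    rw [le_div_iff₀ (by positivity)] at hy1 ⊢
    linarith
  unfold tt
  calc |κ (k+4)| * y ^ (k+4) / (k+4).factorial
      ≤ 2 ^ (k+3) * (k+4 : ℝ) ^ (k+2) * Q ^ (k+3) * (L ^ k * A) * y ^ (k+4) / (k+4).factorial := by
        gcongr; exact hκ k
    _ = Q ^ 3 * A * y ^ 4 * (2 ^ (k+3) * (k+4 : ℝ) ^ (k+2) / (k+4).factorial * (Q * L * y) ^ k) := by
        rw [mul_pow, mul_pow]; ring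
    _ ≤ _ := by gcongr

theorem kap_summable (κ : ℕ → ℝ) (Q L A : ℝ) (hQ : 0 < Q) (hL : 0 < L) (hA : 0 ≤ A)
    (hκ : ∀ k : ℕ, |κ (k+4)| ≤ 2 ^ (k+3) * (k+4 : ℝ) ^ (k+2) * Q ^ (k+3) * (L ^ k * A)) :
    Summable fun n : ℕ => |κ (n+1)| * (1 / (2 * Real.exp 1 * (Q * L))) ^ n / n.factorial := by
  have he := Real.exp_pos 1
  set y := 1 / (2 * Real.exp 1 * (Q * L)) with hy
  have hy0 : 0 < y := by positivity
  rw [← summable_nat_add_iff 3]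
  refine Summable.of_nonneg_of_le (fun n => by positivity) (fun k => ?_)
    (tt_summable.mul_left (Q ^ 3 * A * y ^ 4 / y))
  have h := kap_term κ Q L A hQ hL hA hκ y hy0.le le_rfl k
  have e : |κ (k+3+1)| * y ^ (k+3) / (k+3).factorial =
      ((k:ℝ)+4) / y * (|κ (k+4)| * y ^ (k+4) / (k+4).factorial) := by
    have : ((k+4).factorial : ℝ) = (k+4) * (k+3).factorial := by
      rw [Nat.factorial_succ]; push_cast; ring
    rw [this]
    have : ((k+3).factorial : ℝ) ≠ 0 := by positivity
    have : (k:ℝ) + 4 ≠ 0 := by positivity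
    field_simp
    ring_nf
  rw [e]
  calc _ ≤ ((k:ℝ)+4) / y * (Q ^ 3 * A * y ^ 4 * tt k) := by gcongr
    _ = _ := by ring

theorem kap_tail (κ : ℕ → ℝ) (Q L A : ℝ) (hQ : 0 < Q) (hL : 0 < L) (hA : 0 ≤ A)
    (hκ : ∀ k : ℕ, |κ (k+4)| ≤ 2 ^ (k+3) * (k+4 : ℝ) ^ (k+2) * Q ^ (k+3) * (L ^ k * A))
    (x : ℂ) (hx : ‖x‖ ≤ 1 / (2 * Real.exp 1 * (Q * L))) :
    Summable (fun k : ℕ => (κ (k+3+1) : ℂ) * x ^ (k+3+1) / (k+3+1).factorial) ∧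
    ‖∑' k : ℕ, (κ (k+3+1) : ℂ) * x ^ (k+3+1) / (k+3+1).factorial‖ ≤ 20 * (Q ^ 3 * A) * ‖x‖ ^ 4 := by
  have hb : ∀ k : ℕ, ‖(κ (k+3+1) : ℂ) * x ^ (k+3+1) / (k+3+1).factorial‖ ≤
      Q ^ 3 * A * ‖x‖ ^ 4 * tt k := by
    intro k
    rw [norm_div, norm_mul, norm_pow, Complex.norm_real, Complex.norm_natCast, Real.norm_eq_abs]
    exact kap_term κ Q L A hQ hL hA hκ ‖x‖ (norm_nonneg _) hx k
  have hs := tt_summable'.mul_left (Q ^ 3 * A * ‖x‖ ^ 4)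
  refine ⟨Summable.of_norm_bounded hs hb, ?_⟩
  refine (tsum_of_norm_bounded hs.hasSum hb).trans ?_
  rw [tsum_mul_left]
  calc _ ≤ Q ^ 3 * A * ‖x‖ ^ 4 * 20 := by gcongr; exact tt_sum
    _ = _ := by ring

theorem kap_split (κ : ℕ → ℝ) (Q L A : ℝ) (hQ : 0 < Q) (hL : 0 < L) (hA : 0 ≤ A)
    (hκ : ∀ k : ℕ, |κ (k+4)| ≤ 2 ^ (k+3) * (k+4 : ℝ) ^ (k+2) * Q ^ (k+3) * (L ^ k * A))
    (x : ℂ) (hx : ‖x‖ ≤ 1 / (2 * Real.exp 1 * (Q * L))) :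
    ∃ β : ℂ, ‖β‖ ≤ 20 * (Q ^ 3 * A) * ‖x‖ ^ 4 ∧
      ∑' n : ℕ, (κ (n+1) : ℂ) * x ^ (n+1) / (n+1).factorial =
        κ 1 * x + κ 2 * x ^ 2 / 2 + κ 3 * x ^ 3 / 6 + β := by
  obtain ⟨hts, htb⟩ := kap_tail κ Q L A hQ hL hA hκ x hx
  refine ⟨_, htb, ?_⟩
  have hsplit := ((summable_nat_add_iff (f := fun n : ℕ => (κ (n+1) : ℂ) * x ^ (n+1) / (n+1).factorial) 3).mp hts).sum_add_tsum_nat_add 3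
  rw [← hsplit]
  congr 1
  simp only [Finset.sum_range_succ, Finset.sum_range_zero]
  norm_num [Nat.factorial]

theorem cubic_int {Ω : Type*} [MeasurableSpace Ω] (μ : Measure Ω) [IsProbabilityMeasure μ]
    (Z : Ω → ℝ) (hZ : ∀ n : ℕ, Integrable (fun ω => Z ω ^ n) μ) (a b c d : ℝ) :
    ∫ ω, (a * Z ω ^ 3 + b * Z ω ^ 2 + c * Z ω ^ 1 + d) ∂μ =
      a * ∫ ω, Z ω ^ 3 ∂μ + b * ∫ ω, Z ω ^ 2 ∂μ + c * ∫ ω, Z ω ^ 1 ∂μ + d := by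
  have h3 := (hZ 3).const_mul a
  have h2 := (hZ 2).const_mul b
  have h1 := (hZ 1).const_mul c
  have e1 := integral_add (h3.add h2 |>.add h1) (integrable_const d)
  have e2 := integral_add (h3.add h2) h1
  have e3 := integral_add h3 h2
  simp only [Pi.add_apply] at e1 e2 e3
  rw [e1, e2, e3, integral_const_mul, integral_const_mul, integral_const_mul]
  simp

set_option maxHeartbeats 400000 in
theorem char_form {Ω V : Type*} [MeasurableSpace Ω] [Fintype V]
    (μ : Measure Ω) [IsProbabilityMeasure μ]
    (Y : V → Ω → ℝ) (hYmeas : ∀ k, Measurable (Y k))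
    (G : SimpleGraph V) [DecidableRel G.Adj]
    (hG : IsDependencyGraph μ G Y)
    (D : ℕ) (hD : ∀ k, G.degree k ≤ D)
    (c : V → ℝ)
    (L : ℝ) (hL : 0 < L)
    (hbdd : ∀ k, ∀ᵐ ω ∂μ, |Y k ω - c k| ≤ L)
    (S : Ω → ℝ) (hS : S = fun ω => ∑ k, Y k ω)
    (v : ℝ) (hv : v = Real.sqrt (variance S μ)) (hvpos : 0 < v)
    (W : Ω → ℝ) (hW : W = fun ω => (S ω - ∫ ω', S ω' ∂μ) / v)
    (A₄ : ℝ) (hA₄ : A₄ = ∑ k, ∫ ω, |Y k ω - c k| ^ 4 ∂μ)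
    (s : ℝ) (hs : |s| * (L * (D+1) / v) < 1 / (2 * Real.exp 1)) :
    ∃ β : ℂ, ‖β‖ ≤ 20 * ((D+1)^3 * A₄ / v ^ 4) * s ^ 4 ∧
      ∫ ω, Complex.exp (Complex.I * s * W ω) ∂μ =
        Complex.exp (-(s^2/2 : ℝ)) * Complex.exp (Complex.I *
          ((-((∫ ω, (S ω - ∫ ω', S ω' ∂μ) ^ 3 ∂μ) * s ^ 3 / (6 * v ^ 3)) : ℝ) : ℂ) + β) := by
  obtain ⟨κ, hrec, hκ⟩ := cumulants μ Y hYmeas G hG D hD c L hL.le hbdd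
  have he := Real.exp_pos 1
  have hXm : ∀ k, Measurable (fun ω => Y k ω - c k) := fun k => (hYmeas k).sub_const _
  set Z : Ω → ℝ := fun ω => ∑ k, (Y k ω - c k) with hZ
  set m : ℕ → ℝ := fun n => ∫ ω, Z ω ^ n ∂μ with hm
  have hrec' : ∀ n, m (n+1) = ∑ x ∈ Finset.HasAntidiagonal.antidiagonal n,
        (n.choose x.1 : ℝ) * (κ (x.1 + 1) * m x.2) := hrec
  have hZb : ∀ᵐ ω ∂μ, |Z ω| ≤ Fintype.card V * L := Wd.S_bound (X := fun k ω => Y k ω - c k) hXm hL.le hbdd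
  set R : ℝ := Fintype.card V * L with hR
  have hR0 : 0 ≤ R := by positivity
  have hZm : Measurable Z := Finset.measurable_sum _ fun k _ => hXm k
  have hZint : ∀ n : ℕ, Integrable (fun ω => Z ω ^ n) μ := by
    intro n
    refine Integrable.of_bound (hZm.pow_const n).aestronglyMeasurable (R ^ n) ?_
    filter_upwards [hZb] with ω h
    rw [norm_pow, Real.norm_eq_abs]
    gcongr
  have hZ1 : Integrable Z μ := by simpa using hZint 1
  have h0 : m 0 = 1 := by simp [hm]
  have hmb : ∀ n, |m n| ≤ R ^ n := by
    intro n
    have := norm_integral_le_of_norm_le_const (μ := μ) (f := fun ω => Z ω ^ n) (C := R ^ n) ?_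
    · simpa using this
    filter_upwards [hZb] with ω h
    rw [norm_pow, Real.norm_eq_abs]
    gcongr
  have hA0 : 0 ≤ A₄ := by
    rw [hA₄]; exact Finset.sum_nonneg fun k _ => integral_nonneg fun ω => by positivity
  have hκ' : ∀ k : ℕ, |κ (k+4)| ≤ 2 ^ (k+3) * (k+4 : ℝ) ^ (k+2) * (D+1:ℝ) ^ (k+3) * (L ^ k * A₄) := by
    intro k
    have h := hκ (k+3) (by omega)
    have e : k + 3 - 1 = k + 2 := by omega
    rw [e] at h
    have e2 : (((k+3 : ℕ) : ℝ) + 1) = k + 4 := by push_cast; ring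
    rw [e2] at h
    refine h.trans ?_
    gcongr
    rw [hA₄, Finset.mul_sum]
    gcongr with j _
    rw [← integral_const_mul]
    refine integral_mono_ae (Wd.absX_int (X := fun k ω => Y k ω - c k) hXm hL.le hbdd j _)
      ((Wd.absX_int (X := fun k ω => Y k ω - c k) hXm hL.le hbdd j 4).const_mul _) ?_
    filter_upwards [hbdd j] with ω h
    show |Y j ω - c j| ^ (k+3+1) ≤ L ^ k * |Y j ω - c j| ^ 4
    have : |Y j ω - c j| ^ (k+3+1) = |Y j ω - c j| ^ k * |Y j ω - c j| ^ 4 := by ring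
    rw [this]
    gcongr
  have hQ : (0:ℝ) < (D:ℝ)+1 := by positivity
  have hSZ : S = fun ω => Z ω + ∑ k, c k := by
    rw [hS, hZ]; funext ω; simp
  have hES : ∫ ω, S ω ∂μ = m 1 + ∑ k, c k := by
    rw [hSZ, integral_add hZ1 (integrable_const _)]
    simp [hm]
  have hSc : ∀ ω, S ω - ∫ ω', S ω' ∂μ = Z ω - m 1 := by
    intro ω; rw [hES, hSZ]; ring
  have hk1 : κ 1 = m 1 := by
    have := hrec' 0
    simp [h0] at this
    linarith
  have hk2 : κ 2 = m 2 - m 1 ^ 2 := by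
    have := hrec' 1
    simp [h0, Finset.Nat.antidiagonal_succ] at this
    rw [hk1] at this
    linarith
  have hk3 : κ 3 = m 3 - 3 * m 1 * m 2 + 2 * m 1 ^ 3 := by
    have := hrec' 2
    simp [h0, Finset.Nat.antidiagonal_succ] at this
    rw [hk1, hk2] at this
    linarith
  have hv2 : κ 2 = v ^ 2 := by
    rw [hv, Real.sq_sqrt (variance_nonneg _ _), variance_eq_integral (by
      rw [hSZ]; exact (hZm.add_const _).aemeasurable), hk2]
    simp_rw [hSc]
    have : ∀ ω, (Z ω - m 1) ^ 2 = 0 * Z ω ^ 3 + 1 * Z ω ^ 2 + (-2 * m 1) * Z ω ^ 1 + m 1 ^ 2 := fun ω => by ring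
    simp_rw [this]
    rw [cubic_int μ Z hZint]
    change m 2 - m 1 ^ 2 = 0 * m 3 + 1 * m 2 + (-2 * m 1) * m 1 + m 1 ^ 2
    ring
  have hc3 : ∫ ω, (S ω - ∫ ω', S ω' ∂μ) ^ 3 ∂μ = κ 3 := by
    rw [hk3]
    simp_rw [hSc]
    have : ∀ ω, (Z ω - m 1) ^ 3 = 1 * Z ω ^ 3 + (-3 * m 1) * Z ω ^ 2 + (3 * m 1 ^ 2) * Z ω ^ 1 + (-m 1 ^ 3) := fun ω => by ring
    simp_rw [this]
    rw [cubic_int μ Z hZint]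
    change 1 * m 3 + (-3 * m 1) * m 2 + (3 * m 1 ^ 2) * m 1 + (- m 1 ^ 3) = m 3 - 3 * m 1 * m 2 + 2 * m 1 ^ 3
    ring
  rw [hc3]
  set x : ℂ := Complex.I * ((s / v : ℝ) : ℂ) with hx
  have hxn : ‖x‖ = |s| / v := by
    rw [hx, norm_mul, Complex.norm_I, Complex.norm_real, one_mul, Real.norm_eq_abs, abs_div, abs_of_pos hvpos]
  have hxlt : ‖x‖ < 1 / (2 * Real.exp 1 * ((D+1 : ℝ) * L)) := by
    rw [hxn]
    rw [lt_div_iff₀ (by positivity)] at hs ⊢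
    calc _ = |s| * (L * (D + 1) / v) * (2 * Real.exp 1) := by ring
      _ < 1 := hs
  obtain ⟨β, htb, hsplit⟩ := kap_split κ (D+1) L A₄ hQ hL hA0 hκ' x hxlt.le
  have hexp := egf_exp m κ h0 hrec' _ (by positivity) (kap_summable κ (D+1) L A₄ hQ hL hA0 hκ') R hmb hR0 x hxlt
  have hmom := exp_moment μ Z hZm R hR0 hZb x
  replace hmom := hmom.trans (hexp.trans (congrArg Complex.exp hsplit))
  refine ⟨β, ?_, ?_⟩
  · refine htb.trans (le_of_eq ?_)
    rw [hxn, div_pow, Even.pow_abs (by decide)]; ring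
  have hWx : ∀ ω, Complex.exp (Complex.I * s * W ω) = Complex.exp (- x * m 1) * Complex.exp (x * Z ω) := by
    intro ω
    rw [← Complex.exp_add]
    congr 1
    have hvc : (v:ℂ) ≠ 0 := by exact_mod_cast hvpos.ne'
    rw [hW]
    simp only [hSc, hx]
    push_cast
    field_simp
    ring
  simp_rw [hWx]
  rw [integral_const_mul, hmom, ← Complex.exp_add, ← Complex.exp_add]
  congr 1
  rw [hk1, hv2, hx]
  have hvc : (v:ℂ) ≠ 0 := by exact_mod_cast hvpos.ne'
  push_cast
  simp only [mul_pow, Complex.I_sq, Complex.I_pow_three, div_pow]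
  field_simp
  ring


/-- Fejer kernel -/
def Vk (T y : ℝ) : ℝ := T / (2 * Real.pi) * Real.sinc (T * y / 2) ^ 2

theorem Vk_cont (T : ℝ) : Continuous (Vk T) := by
  unfold Vk
  exact continuous_const.mul ((Real.continuous_sinc.comp (by fun_prop)).pow 2)

theorem Vk_nonneg {T : ℝ} (hT : 0 < T) (y : ℝ) : 0 ≤ Vk T y := by
  unfold Vk; have := Real.pi_pos; positivity

theorem Vk_neg (T y : ℝ) : Vk T (-y) = Vk T y := by
  unfold Vk
  rw [show T * -y / 2 = -(T * y / 2) by ring, Real.sinc_neg]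

theorem Vk_eq {T : ℝ} (hT : 0 < T) {y : ℝ} (hy : y ≠ 0) :
    Vk T y = (1 - Real.cos (T * y)) / (Real.pi * T * y ^ 2) := by
  unfold Vk
  have hpi := Real.pi_pos
  rw [Real.sinc_of_ne_zero (by positivity)]
  have : Real.cos (T * y) = 1 - 2 * Real.sin (T * y / 2) ^ 2 := by
    rw [show T * y = 2 * (T * y / 2) by ring, Real.cos_two_mul, Real.cos_sq']; ring_nf
  rw [this]
  field_simp
  ring

theorem Vk_le {T : ℝ} (hT : 0 < T) {y : ℝ} (hy : y ≠ 0) :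
    Vk T y ≤ 2 / (Real.pi * T) * (y ^ 2)⁻¹ := by
  have hpi := Real.pi_pos
  rw [Vk_eq hT hy, ← div_eq_mul_inv, div_div]
  gcongr
  linarith [Real.neg_one_le_cos (T * y)]

theorem Vk_le' {T : ℝ} (hT : 0 < T) (y : ℝ) : Vk T y ≤ T / (2 * Real.pi) := by
  have hpi := Real.pi_pos
  unfold Vk
  have : Real.sinc (T * y / 2) ^ 2 ≤ 1 := by
    rw [← sq_abs]; exact pow_le_one₀ (abs_nonneg _) (Real.abs_sinc_le_one _)
  exact mul_le_of_le_one_right (by positivity) this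

theorem Vk_int {T : ℝ} (hT : 0 < T) : Integrable (Vk T) := by
  have hpi := Real.pi_pos
  refine (integrable_inv_one_add_sq.const_mul (T / (2 * Real.pi) + 2 / (Real.pi * T))).mono'
    (Vk_cont T).aestronglyMeasurable (Eventually.of_forall fun y => ?_)
  rw [Real.norm_eq_abs, abs_of_nonneg (Vk_nonneg hT y), ← div_eq_mul_inv, le_div_iff₀ (by positivity)]
  have h1 := Vk_le' hT y
  have h2 : Vk T y * y ^ 2 ≤ 2 / (Real.pi * T) := by
    by_cases hy : y = 0
    · subst hy; simp; positivity
    · have := Vk_le hT hy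
      rwa [← div_eq_mul_inv, le_div_iff₀ (by positivity)] at this
  linarith

theorem Vk_cos {T : ℝ} (hT : 0 < T) (y : ℝ) :
    ∫ ζ in (0:ℝ)..T, (1 - ζ / T) * Real.cos (ζ * y) = Real.pi * Vk T y := by
  have hpi := Real.pi_pos
  by_cases hy : y = 0
  · subst hy
    simp only [mul_zero, Real.cos_zero, mul_one, Vk]
    rw [intervalIntegral.integral_sub (by simp) (by apply Continuous.intervalIntegrable; fun_prop)]
    simp
    field_simp
    norm_num
  · rw [Vk_eq hT hy]
    have hd : ∀ ζ ∈ Set.uIcc 0 T, HasDerivAt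
        (fun ζ => (1 - ζ / T) * (Real.sin (ζ * y) / y) - Real.cos (ζ * y) / (T * y ^ 2))
        ((1 - ζ / T) * Real.cos (ζ * y)) ζ := by
      intro ζ _
      have h0 : HasDerivAt (fun ζ : ℝ => ζ * y) y ζ := by simpa using (hasDerivAt_id ζ).mul_const y
      have h1 : HasDerivAt (fun ζ : ℝ => 1 - ζ / T) (-(1 / T)) ζ := by
        simpa using ((hasDerivAt_id ζ).div_const T).const_sub 1
      have := (h1.mul (h0.sin.div_const y)).sub (h0.cos.div_const (T * y ^ 2))
      refine this.congr_deriv ?_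
      field_simp
      ring
    rw [intervalIntegral.integral_eq_sub_of_hasDerivAt hd (by apply Continuous.intervalIntegrable; fun_prop)]
    simp
    field_simp
    ring

open FourierTransform in
theorem Vk_integral {T : ℝ} (hT : 0 < T) : ∫ y, Vk T y = 1 := by
  have hpi := Real.pi_pos
  set f : ℝ → ℂ := fun ζ => ((max 0 (1 - |ζ| / T) : ℝ) : ℂ) with hf
  have hfc : Continuous f := by rw [hf]; fun_prop
  have hcs : HasCompactSupport f := by
    refine HasCompactSupport.intro (isCompact_Icc (a := -T) (b := T)) fun ζ hζ => ?_
    simp only [hf]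
    rw [max_eq_left, Complex.ofReal_zero]
    have : T ≤ |ζ| := by
      by_contra h
      push Not at h
      exact hζ (abs_le.mp h.le)
    have : 1 ≤ |ζ| / T := by rwa [le_div_iff₀ hT, one_mul]
    linarith
  have hfi : Integrable f := hfc.integrable_of_hasCompactSupport hcs
  have hF : 𝓕 f = fun w => ((2 * Real.pi * Vk T (2 * Real.pi * w) : ℝ) : ℂ) := by
    funext w
    rw [Real.fourier_eq']
    have hA : ∀ ζ : ℝ, Complex.exp (↑(-2 * Real.pi * inner ℝ ζ w) * Complex.I) • f ζ =
        ((max 0 (1 - |ζ| / T) * Real.cos (|ζ| * (2 * Real.pi * w)) : ℝ) : ℂ) -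
        ((max 0 (1 - |ζ| / T) * Real.sin (ζ * (2 * Real.pi * w)) : ℝ) : ℂ) * Complex.I := by
      intro ζ
      have hc : Real.cos (|ζ| * (2 * Real.pi * w)) = Real.cos (ζ * (2 * Real.pi * w)) := by
        rcases abs_choice ζ with h | h <;> rw [h]
        rw [neg_mul, Real.cos_neg]
      rw [hc, show (-2 * Real.pi * inner ℝ ζ w : ℝ) = -(ζ * (2 * Real.pi * w)) by simp; ring]
      rw [Complex.exp_mul_I, ← Complex.ofReal_cos, ← Complex.ofReal_sin, Real.cos_neg, Real.sin_neg, hf]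
      simp only [smul_eq_mul]
      push_cast
      ring
    simp_rw [hA]
    have hg : ∀ g : ℝ → ℝ, Continuous g → Integrable fun ζ : ℝ => max 0 (1 - |ζ| / T) * g ζ := by
      intro g hg
      refine Continuous.integrable_of_hasCompactSupport (by fun_prop) ?_
      have : HasCompactSupport fun ζ : ℝ => max 0 (1 - |ζ| / T) := by
        refine hcs.comp_left (g := Complex.re) rfl
      exact this.mul_right
    have i1 := hg (fun ζ => Real.cos (|ζ| * (2 * Real.pi * w))) (by fun_prop)
    have i2 := hg (fun ζ => Real.sin (ζ * (2 * Real.pi * w))) (by fun_prop)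
    rw [integral_sub i1.ofReal (i2.ofReal.mul_const _), integral_mul_const, integral_complex_ofReal,
      integral_complex_ofReal]
    have z2 : ∫ ζ : ℝ, max 0 (1 - |ζ| / T) * Real.sin (ζ * (2 * Real.pi * w)) = 0 := by
      have := integral_neg_eq_self (fun ζ : ℝ => max 0 (1 - |ζ| / T) * Real.sin (ζ * (2 * Real.pi * w))) volume
      simp only [abs_neg, neg_mul, Real.sin_neg, mul_neg, integral_neg] at this
      linarith
    rw [z2, integral_comp_abs (f := fun ζ => max 0 (1 - ζ / T) * Real.cos (ζ * (2 * Real.pi * w)))]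
    have z1 : ∫ ζ in Set.Ioi (0:ℝ), max 0 (1 - ζ / T) * Real.cos (ζ * (2 * Real.pi * w)) =
        ∫ ζ in (0:ℝ)..T, (1 - ζ / T) * Real.cos (ζ * (2 * Real.pi * w)) := by
      rw [intervalIntegral.integral_of_le hT.le]
      symm
      have : Set.Ioc (0:ℝ) T ⊆ Set.Ioi 0 := fun x hx => hx.1
      rw [setIntegral_congr_fun (g := fun ζ => max 0 (1 - ζ / T) * Real.cos (ζ * (2 * Real.pi * w))) measurableSet_Ioc]
      · refine (setIntegral_eq_of_subset_of_forall_diff_eq_zero measurableSet_Ioi this ?_).symm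
        intro x hx
        have hx1 : (0:ℝ) < x := hx.1
        have hx2 : T < x := by
          by_contra h
          exact hx.2 ⟨hx1, not_lt.mp h⟩
        have : 1 ≤ x / T := by rw [le_div_iff₀ hT]; linarith
        show max 0 (1 - x / T) * _ = 0
        rw [max_eq_left (by linarith), zero_mul]
      · intro x hx
        have : x / T ≤ 1 := by rw [div_le_iff₀ hT]; linarith [hx.2]
        show _ = max 0 (1 - x / T) * _
        rw [max_eq_right (by linarith)]
    rw [z1, Vk_cos hT]
    push_cast
    ring
  have hVs : Integrable fun w => Vk T (2 * Real.pi * w) := (Vk_int hT).comp_mul_left' (by positivity)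
  have hFi : Integrable (𝓕 f) := by
    rw [hF]; exact (hVs.const_mul _).ofReal
  have := hfi.fourierInv_fourier_eq hFi (v := 0) hfc.continuousAt
  rw [Real.fourierInv_eq'] at this
  simp only [inner_zero_right, mul_zero, Complex.ofReal_zero, zero_mul, Complex.exp_zero, one_smul] at this
  rw [hF, integral_complex_ofReal] at this
  simp only [hf, abs_zero, zero_div, sub_zero] at this
  norm_num at this
  rw [integral_const_mul, Measure.integral_comp_mul_left] at this
  rw [abs_of_pos (by positivity), smul_eq_mul] at this
  rw [← this]
  field_simp


theorem Vk_tail {T : ℝ} (hT : 0 < T) {h : ℝ} (hh : 0 < h) :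
    ∫ y, (if h < |y| then Vk T y else 0) ≤ 4 / (Real.pi * T * h) := by
  have hpi := Real.pi_pos
  have e : ∀ y : ℝ, (if h < |y| then Vk T y else 0) = (Set.Ioi h).indicator (Vk T) |y| := by
    intro y
    have : Vk T |y| = Vk T y := by
      rcases abs_choice y with h | h <;> rw [h]
      exact Vk_neg _ _
    simp [Set.indicator, this]
  simp_rw [e]
  rw [integral_comp_abs (f := (Set.Ioi h).indicator (Vk T)), setIntegral_indicator measurableSet_Ioi]
  have : Set.Ioi (0:ℝ) ∩ Set.Ioi h = Set.Ioi h := Set.inter_eq_right.mpr fun x (hx : h < x) => hh.trans hx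
  rw [this]
  have hb : ∫ y in Set.Ioi h, Vk T y ≤ ∫ y in Set.Ioi h, 2 / (Real.pi * T) * y ^ (-2 : ℝ) := by
    refine setIntegral_mono_on (Vk_int hT).integrableOn
      ((integrableOn_Ioi_rpow_of_lt (by norm_num) hh).const_mul _) measurableSet_Ioi ?_
    intro y hy
    have hy0 : 0 < y := hh.trans hy
    refine (Vk_le hT hy0.ne').trans (le_of_eq ?_)
    rw [Real.rpow_neg hy0.le]
    norm_num
  rw [integral_const_mul, integral_Ioi_rpow_of_lt (by norm_num) hh] at hb
  have e2 : -h ^ (-2 + 1 : ℝ) / (-2 + 1) = h⁻¹ := by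
    rw [show (-2 + 1 : ℝ) = -1 by norm_num, Real.rpow_neg_one]; ring
  rw [e2] at hb
  calc _ ≤ 2 * (2 / (Real.pi * T) * h⁻¹) := by gcongr
    _ = _ := by field_simp; norm_num

theorem smooth_core {T : ℝ} (hT : 0 < T) (Δ : ℝ → ℝ) (hΔ : Measurable Δ) (η M : ℝ) (hη : 0 < η)
    (hM : 0 < M) (hb : ∀ x, |Δ x| ≤ η) (hmono : ∀ a b, a ≤ b → Δ a - M * (b - a) ≤ Δ b) (x0 : ℝ) :
    Δ x0 ≤ η / 2 + (∫ y, Δ (x0 + η / (2 * M) - y) * Vk T y) + 12 * M / (Real.pi * T) := by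
  have hpi := Real.pi_pos
  set h := η / (2 * M) with hh
  have hh0 : 0 < h := by positivity
  have hMh : M * h = η / 2 := by rw [hh]; field_simp
  have hV := Vk_int hT
  have hVn := Vk_nonneg hT
  have hVc := Vk_cont T
  have hms : MeasurableSet {y : ℝ | h < |y|} := measurableSet_lt measurable_const measurable_norm
  have i3 : Integrable fun y => if h < |y| then Vk T y else 0 := hV.indicator hms
  have i2 : Integrable fun y => if h < |y| then 0 else y * Vk T y := by
    refine (hV.const_mul h).mono' (Measurable.ite hms measurable_const
      (measurable_id.mul hVc.measurable)).aestronglyMeasurable (Eventually.of_forall fun y => ?_)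
    split_ifs with hy
    · simp; exact mul_nonneg hh0.le (hVn y)
    · rw [norm_mul, Real.norm_eq_abs, Real.norm_eq_abs, abs_of_nonneg (hVn y)]
      exact mul_le_mul_of_nonneg_right (not_lt.mp hy) (hVn y)
  have iL : Integrable fun y => Δ (x0 + h - y) * Vk T y := by
    refine (hV.const_mul η).mono' ((hΔ.comp (by fun_prop)).mul hVc.measurable).aestronglyMeasurable
      (Eventually.of_forall fun y => ?_)
    rw [norm_mul, Real.norm_eq_abs, Real.norm_eq_abs, abs_of_nonneg (hVn y)]
    exact mul_le_mul_of_nonneg_right (hb _) (hVn y)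
  set δ := Δ x0 with hδ
  have key : ∀ y, (δ - η / 2) * Vk T y + M * (if h < |y| then 0 else y * Vk T y) -
      (δ + η / 2) * (if h < |y| then Vk T y else 0) ≤ Δ (x0 + h - y) * Vk T y := by
    intro y
    split_ifs with hy
    · have := (abs_le.mp (hb (x0 + h - y))).1
      nlinarith [hVn y]
    · have hy' := abs_le.mp (not_lt.mp hy)
      have := hmono x0 (x0 + h - y) (by linarith)
      have h2 : δ - η / 2 + M * y ≤ Δ (x0 + h - y) := by
        rw [← hMh]; linarith
      have := mul_le_mul_of_nonneg_right h2 (hVn y)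
      linarith
  have hIntg := integral_mono (((hV.const_mul (δ - η / 2)).add (i2.const_mul M)).sub (i3.const_mul (δ + η / 2))) iL key
  have e1 := integral_sub ((hV.const_mul (δ - η / 2)).add (i2.const_mul M)) (i3.const_mul (δ + η / 2))
  have e2 := integral_add (hV.const_mul (δ - η / 2)) (i2.const_mul M)
  simp only [Pi.add_apply, Pi.sub_apply] at e1 e2 hIntg
  rw [e1, e2, integral_const_mul, integral_const_mul, integral_const_mul, Vk_integral hT] at hIntg
  have z : ∫ y, (if h < |y| then 0 else y * Vk T y) = 0 := by
    have := integral_neg_eq_self (fun y => if h < |y| then 0 else y * Vk T y) volume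
    have e : ∀ y, (if h < |-y| then 0 else -y * Vk T (-y)) = -(if h < |y| then 0 else y * Vk T y) := by
      intro y
      rw [abs_neg, Vk_neg]
      split_ifs <;> ring
    simp_rw [e] at this
    rw [integral_neg] at this
    linarith
  rw [z] at hIntg
  have ht := Vk_tail hT hh0
  have ht0 : 0 ≤ ∫ y, (if h < |y| then Vk T y else 0) :=
    integral_nonneg fun y => by
      show 0 ≤ if h < |y| then Vk T y else 0
      split_ifs
      · exact hVn y
      · exact le_rfl
  have hδ1 : δ ≤ η := (abs_le.mp (hb x0)).2
  have hfin : (δ + η / 2) * ∫ y, (if h < |y| then Vk T y else 0) ≤ 12 * M / (Real.pi * T) := by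
    calc _ ≤ (3 / 2 * η) * ∫ y, (if h < |y| then Vk T y else 0) :=
          mul_le_mul_of_nonneg_right (by linarith) ht0
      _ ≤ (3 / 2 * η) * (4 / (Real.pi * T * h)) := by gcongr
      _ = _ := by rw [hh]; field_simp; norm_num
  linarith

theorem smooth_both {T : ℝ} (hT : 0 < T) (Δ : ℝ → ℝ) (hΔ : Measurable Δ) (η M I : ℝ) (hη : 0 < η)
    (hM : 0 < M) (hb : ∀ x, |Δ x| ≤ η) (hmono : ∀ a b, a ≤ b → Δ a - M * (b - a) ≤ Δ b)
    (hI : ∀ t, |∫ y, Δ (t - y) * Vk T y| ≤ I) (x0 : ℝ) :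
    |Δ x0| ≤ η / 2 + I + 12 * M / (Real.pi * T) := by
  have h1 := smooth_core hT Δ hΔ η M hη hM hb hmono x0
  have h2 := smooth_core hT (fun x => -Δ (-x)) (hΔ.comp measurable_neg).neg η M hη hM
    (fun x => by rw [abs_neg]; exact hb _) (fun a b hab => by
      have := hmono (-b) (-a) (by linarith)
      linarith) (-x0)
  have e : ∫ y, -Δ (-(-x0 + η / (2 * M) - y)) * Vk T y = - ∫ y, Δ ((x0 - η / (2 * M)) - y) * Vk T y := by
    rw [← integral_neg_eq_self, ← integral_neg]
    congr 1; funext y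
    rw [Vk_neg]
    rw [show -(-x0 + η / (2 * M) - -y) = x0 - η / (2 * M) - y by ring]
    ring
  rw [e] at h2
  simp only [neg_neg] at h2
  have i1 := (abs_le.mp (hI (x0 + η / (2 * M)))).2
  have i2 := (abs_le.mp (hI (x0 - η / (2 * M)))).1
  rw [abs_le]
  constructor <;> linarith

theorem smooth_sup {T : ℝ} (hT : 0 < T) (Δ : ℝ → ℝ) (hΔ : Measurable Δ) (M I : ℝ)
    (hM : 0 < M) (hb : ∀ x, |Δ x| ≤ 1) (hmono : ∀ a b, a ≤ b → Δ a - M * (b - a) ≤ Δ b)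
    (hI : ∀ t, |∫ y, Δ (t - y) * Vk T y| ≤ I) (x0 : ℝ) :
    |Δ x0| ≤ 2 * I + 24 * M / (Real.pi * T) := by
  have hpi := Real.pi_pos
  have hI0 : 0 ≤ I := (abs_nonneg _).trans (hI 0)
  have hbd : BddAbove (Set.range fun x => |Δ x|) := ⟨1, by rintro _ ⟨x, rfl⟩; exact hb x⟩
  set η := ⨆ x, |Δ x| with hη
  have hle : ∀ x, |Δ x| ≤ η := fun x => le_ciSup hbd x
  rcases le_or_gt η 0 with h | h
  · refine (hle x0).trans (h.trans ?_)
    positivity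
  · have h1 : η ≤ η / 2 + I + 12 * M / (Real.pi * T) :=
      ciSup_le fun x => smooth_both hT Δ hΔ η M I h hM hle hmono hI x
    refine (hle x0).trans ?_
    have : 24 * M / (Real.pi * T) = 2 * (12 * M / (Real.pi * T)) := by ring
    linarith

theorem int_cos_sinc (ζ u : ℝ) : ∫ y in (0:ℝ)..u, Real.cos (ζ * y) = u * Real.sinc (ζ * u) := by
  by_cases hζ : ζ = 0
  · simp [hζ]
  by_cases hu : u = 0
  · simp [hu]
  rw [Real.sinc_of_ne_zero (mul_ne_zero hζ hu), intervalIntegral.integral_comp_mul_left _ hζ]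
  simp
  field_simp

theorem int_Vk {T : ℝ} (hT : 0 < T) (u : ℝ) :
    ∫ y in (0:ℝ)..u, Vk T y = 1 / Real.pi * ∫ ζ in (0:ℝ)..T, (1 - ζ / T) * (u * Real.sinc (ζ * u)) := by
  have hpi := Real.pi_pos
  have e : ∀ y, Vk T y = 1 / Real.pi * ∫ ζ in (0:ℝ)..T, (1 - ζ / T) * Real.cos (ζ * y) := by
    intro y; rw [Vk_cos hT]; field_simp
  simp_rw [e]
  rw [intervalIntegral.integral_const_mul, intervalIntegral_intervalIntegral_swap]
  · congr 1
    refine intervalIntegral.integral_congr fun ζ _ => ?_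
    rw [intervalIntegral.integral_const_mul, int_cos_sinc]
  · have hc : Continuous (Function.uncurry fun y ζ : ℝ => (1 - ζ / T) * Real.cos (ζ * y)) := by
      unfold Function.uncurry; fun_prop
    exact (hc.continuousOn.integrableOn_compact (isCompact_uIcc.prod isCompact_uIcc)).mono_set
      (Set.prod_mono Set.uIoc_subset_uIcc Set.uIoc_subset_uIcc)

theorem conv_int (ν : Measure ℝ) [IsProbabilityMeasure ν] (hν : Integrable (fun x : ℝ => x) ν)
    {T : ℝ} (hT : 0 < T) (t : ℝ) :
    Integrable (Function.uncurry fun ζ x : ℝ => (1 - ζ / T) * ((t - x) * Real.sinc (ζ * (t - x))))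
      ((volume.restrict (Set.uIoc 0 T)).prod ν) := by
  have h1 : Integrable (fun x : ℝ => |t - x|) ν := ((integrable_const t).sub hν).abs
  haveI : IsFiniteMeasure ((volume : Measure ℝ).restrict (Set.uIoc 0 T)) := by
    rw [Set.uIoc_of_le hT.le]; infer_instance
  have h2 : Integrable (fun z : ℝ × ℝ => 1 * |t - z.2|) ((volume.restrict (Set.uIoc 0 T)).prod ν) :=
    (integrable_const (1:ℝ)).mul_prod h1
  have hc : Continuous (Function.uncurry fun ζ x : ℝ => (1 - ζ / T) * ((t - x) * Real.sinc (ζ * (t - x)))) := by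
    unfold Function.uncurry
    have := Real.continuous_sinc
    fun_prop
  refine h2.mono' hc.aestronglyMeasurable ?_
  have hae : ∀ᵐ z : ℝ × ℝ ∂((volume.restrict (Set.uIoc 0 T)).prod ν), z.1 ∈ Set.uIoc 0 T := by
    have h := ae_restrict_mem (μ := (volume : Measure ℝ)) (measurableSet_uIoc (a := (0:ℝ)) (b := T))
    exact Measure.quasiMeasurePreserving_fst.ae h
  filter_upwards [hae] with z hz
  rw [Set.uIoc_of_le hT.le] at hz
  have a1 : z.1 / T ≤ 1 := by rw [div_le_iff₀ hT]; linarith [hz.2]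
  have a2 : 0 ≤ z.1 / T := by have := hz.1; positivity
  simp only [Function.uncurry]
  rw [norm_mul, norm_mul, Real.norm_eq_abs, Real.norm_eq_abs, Real.norm_eq_abs]
  have b1 : |1 - z.1 / T| ≤ 1 := by rw [abs_le]; constructor <;> linarith
  have b2 := Real.abs_sinc_le_one (z.1 * (t - z.2))
  calc _ ≤ 1 * (|t - z.2| * 1) := by gcongr
    _ = _ := by ring

theorem conv_eq (ν : Measure ℝ) [IsProbabilityMeasure ν] (hν : Integrable (fun x : ℝ => x) ν)
    {T : ℝ} (hT : 0 < T) (t : ℝ) :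
    ∫ y, ν.real (Set.Iic (t - y)) * Vk T y = (∫ y in Set.Iic (0:ℝ), Vk T y) +
      1 / Real.pi * ∫ ζ in (0:ℝ)..T, ∫ x, (1 - ζ / T) * ((t - x) * Real.sinc (ζ * (t - x))) ∂ν := by
  have hV := Vk_int hT
  have hci := conv_int ν hν hT t
  rw [intervalIntegral_integral_swap hci]
  have hms : MeasurableSet {z : ℝ × ℝ | z.1 + z.2 ≤ t} :=
    measurableSet_le (measurable_fst.add measurable_snd) measurable_const
  have e1 : ∀ y, ν.real (Set.Iic (t - y)) * Vk T y = ∫ x, (if y + x ≤ t then Vk T y else 0) ∂ν := by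
    intro y
    have : ∀ x, (if y + x ≤ t then Vk T y else 0) = (Set.Iic (t - y)).indicator (fun _ => Vk T y) x := by
      intro x
      simp only [Set.indicator, Set.mem_Iic]
      congr 1
      rw [eq_iff_iff]
      constructor <;> intro h <;> linarith
    simp_rw [this]
    rw [integral_indicator measurableSet_Iic, setIntegral_const, smul_eq_mul]
  simp_rw [e1]
  rw [integral_integral_swap]
  swap
  · have h0 : Integrable (fun z : ℝ × ℝ => Vk T z.1 * 1) (volume.prod ν) :=
      hV.mul_prod (integrable_const (1:ℝ))
    refine h0.mono' (Measurable.ite hms ((Vk_cont T).measurable.comp measurable_fst)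
      measurable_const).aestronglyMeasurable (Eventually.of_forall fun z => ?_)
    simp only [Function.uncurry]
    have := Vk_nonneg hT z.1
    split_ifs
    · rw [Real.norm_eq_abs, abs_of_nonneg this]; linarith
    · simpa using this
  have e2 : ∀ x, ∫ y, (if y + x ≤ t then Vk T y else 0) = (∫ y in Set.Iic (0:ℝ), Vk T y) +
      1 / Real.pi * ∫ ζ in (0:ℝ)..T, (1 - ζ / T) * ((t - x) * Real.sinc (ζ * (t - x))) := by
    intro x
    rw [← int_Vk hT, ← intervalIntegral.integral_Iic_sub_Iic hV.integrableOn hV.integrableOn,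
      add_sub_cancel, ← integral_indicator measurableSet_Iic]
    congr 1; funext y
    simp only [Set.indicator, Set.mem_Iic]
    congr 1
    rw [eq_iff_iff]
    constructor <;> intro h <;> linarith
  simp_rw [e2]
  have i2 : Integrable (fun x => ∫ ζ in (0:ℝ)..T, (1 - ζ / T) * ((t - x) * Real.sinc (ζ * (t - x)))) ν := by
    have := hci.integral_prod_right
    simp only [Function.uncurry] at this
    simp_rw [intervalIntegral.integral_of_le hT.le]
    rwa [Set.uIoc_of_le hT.le] at this
  rw [integral_add (integrable_const _) (i2.const_mul _), integral_const_mul]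
  simp

theorem sinc_char (ν : Measure ℝ) [IsProbabilityMeasure ν] (ζ t : ℝ) :
    ζ * ∫ x, (t - x) * Real.sinc (ζ * (t - x)) ∂ν =
      (Complex.exp (ζ * t * Complex.I) * charFun ν (-ζ)).im := by
  rw [charFun_apply_real, ← integral_const_mul, ← integral_const_mul]
  have hi : Integrable (fun x : ℝ => Complex.exp (ζ * t * Complex.I) * Complex.exp (((-ζ : ℝ):ℂ) * x * Complex.I)) ν := by
    refine Integrable.of_bound (by fun_prop) 1 (Eventually.of_forall fun x => ?_)
    rw [norm_mul]
    have a1 := Complex.norm_exp_ofReal_mul_I (ζ * t)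
    have a2 := Complex.norm_exp_ofReal_mul_I (-ζ * x)
    push_cast at a1 a2 ⊢
    rw [a1, a2]; norm_num
  refine Eq.trans ?_ (integral_im hi)
  congr 1; funext x
  have e : Complex.exp (ζ * t * Complex.I) * Complex.exp (((-ζ : ℝ):ℂ) * x * Complex.I) =
      Complex.exp (((ζ * (t - x) : ℝ) : ℂ) * Complex.I) := by
    rw [← Complex.exp_add]; congr 1; push_cast; ring
  rw [e]
  show _ = (Complex.exp (((ζ * (t - x) : ℝ) : ℂ) * Complex.I)).im
  rw [Complex.exp_ofReal_mul_I_im, ← mul_assoc]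
  by_cases h : ζ * (t - x) = 0
  · rw [h]; simp
  · rw [Real.sinc_of_ne_zero h, ← mul_div_assoc, mul_div_cancel_left₀ _ h]

theorem H_diff (ν γ : Measure ℝ) [IsProbabilityMeasure ν] [IsProbabilityMeasure γ] (ζ t g : ℝ) (hζ : 0 < ζ)
    (hg : ‖charFun ν ζ - charFun γ ζ‖ ≤ ζ * g) :
    |(∫ x, (t - x) * Real.sinc (ζ * (t - x)) ∂ν) - ∫ x, (t - x) * Real.sinc (ζ * (t - x)) ∂γ| ≤ g := by
  have h1 := sinc_char ν ζ t
  have h2 := sinc_char γ ζ t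
  refine le_of_mul_le_mul_left ?_ hζ
  refine le_trans ?_ hg
  nth_rewrite 1 [← abs_of_pos hζ]
  rw [← abs_mul, mul_sub, h1, h2, ← Complex.sub_im, ← mul_sub]
  refine (Complex.abs_im_le_norm _).trans ?_
  have a1 := Complex.norm_exp_ofReal_mul_I (ζ * t)
  push_cast at a1
  rw [norm_mul, a1, one_mul, charFun_neg, charFun_neg, ← map_sub, RCLike.norm_conj]

theorem gauss_lip (a b : ℝ) (hab : a ≤ b) :
    (gaussianReal 0 1).real (Set.Iic b) - (gaussianReal 0 1).real (Set.Iic a) ≤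
      1 / Real.sqrt (2 * Real.pi) * (b - a) := by
  have hpi := Real.pi_pos
  have h1 : (gaussianReal 0 1).real (Set.Iic b) - (gaussianReal 0 1).real (Set.Iic a) =
      (gaussianReal 0 1).real (Set.Ioc a b) := by
    have : Set.Iic b = Set.Iic a ∪ Set.Ioc a b := (Set.Iic_union_Ioc_eq_Iic hab).symm
    rw [this, measureReal_union (Set.Iic_disjoint_Ioc le_rfl) measurableSet_Ioc]
    ring
  rw [h1, measureReal_def, gaussianReal_apply_eq_integral _ one_ne_zero]
  rw [ENNReal.toReal_ofReal (integral_nonneg fun x => gaussianPDFReal_nonneg _ _ _)]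
  have := norm_setIntegral_le_of_norm_le_const (μ := volume) (s := Set.Ioc a b) (f := gaussianPDFReal 0 1)
    (C := 1 / Real.sqrt (2 * Real.pi)) (by simp) (fun x _ => by
      rw [Real.norm_eq_abs, abs_of_nonneg (gaussianPDFReal_nonneg _ _ _), gaussianPDFReal]
      simp only [NNReal.coe_one, mul_one, sub_zero]
      rw [one_div]
      refine mul_le_of_le_one_right (by positivity) ?_
      rw [Real.exp_le_one_iff]
      have : 0 ≤ x ^ 2 / 2 := by positivity
      linarith)
  refine (le_abs_self _).trans (this.trans (le_of_eq ?_))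
  rw [measureReal_def, Real.volume_Ioc, ENNReal.toReal_ofReal (by linarith)]

theorem gauss_id_int : Integrable (fun x : ℝ => x) (gaussianReal 0 1) :=
  (memLp_id_gaussianReal' 1 (by simp)).integrable (by simp)

theorem esseen (ν : Measure ℝ) [IsProbabilityMeasure ν] (hν : Integrable (fun x : ℝ => x) ν)
    {T : ℝ} (hT : 0 < T) (g : ℝ → ℝ) (hgi : IntervalIntegrable g volume 0 T)
    (hg : ∀ s, 0 < s → s ≤ T → ‖charFun ν s - charFun (gaussianReal 0 1) s‖ ≤ s * g s) (x : ℝ) :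
    |ν.real (Set.Iic x) - (gaussianReal 0 1).real (Set.Iic x)| ≤
      2 * (1 / Real.pi * ∫ s in (0:ℝ)..T, g s) + 24 * (1 / Real.sqrt (2 * Real.pi)) / (Real.pi * T) := by
  have hpi := Real.pi_pos
  have hcdf : ∀ (m : Measure ℝ) [IsProbabilityMeasure m], Monotone fun x => m.real (Set.Iic x) := by
    intro m _ a b hab
    exact measureReal_mono (Set.Iic_subset_Iic.mpr hab)
  have hmeas : ∀ (m : Measure ℝ) [IsProbabilityMeasure m], Measurable fun x => m.real (Set.Iic x) :=
    fun m _ => (hcdf m).measurable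
  refine smooth_sup hT (fun x => ν.real (Set.Iic x) - (gaussianReal 0 1).real (Set.Iic x))
    ((hmeas ν).sub (hmeas _)) (1 / Real.sqrt (2 * Real.pi)) _ (by positivity) ?_ ?_ ?_ x
  · intro x
    have h1 : ν.real (Set.Iic x) ≤ 1 := measureReal_le_one
    have h2 : (gaussianReal 0 1).real (Set.Iic x) ≤ 1 := measureReal_le_one
    have h3 : 0 ≤ ν.real (Set.Iic x) := measureReal_nonneg
    have h4 : 0 ≤ (gaussianReal 0 1).real (Set.Iic x) := measureReal_nonneg
    rw [abs_le]; constructor <;> linarith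
  · intro a b hab
    have h1 := gauss_lip a b hab
    have h2 := hcdf ν hab
    simp only at h2 ⊢
    linarith
  · intro t
    have hIntg : ∀ (m : Measure ℝ) [IsProbabilityMeasure m], Integrable fun y => m.real (Set.Iic (t - y)) * Vk T y := by
      intro m _
      refine (Vk_int hT).mono' (((hmeas m).comp (by fun_prop : Measurable fun y : ℝ => t - y)).mul
        (Vk_cont T).measurable).aestronglyMeasurable (Eventually.of_forall fun y => ?_)
      have h1 : m.real (Set.Iic (t - y)) ≤ 1 := measureReal_le_one
      have h3 : 0 ≤ m.real (Set.Iic (t - y)) := measureReal_nonneg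
      have h4 := Vk_nonneg hT y
      show ‖m.real (Set.Iic (t - y)) * Vk T y‖ ≤ _
      rw [Real.norm_eq_abs, abs_of_nonneg (mul_nonneg h3 h4)]
      exact mul_le_of_le_one_left h4 h1
    simp_rw [sub_mul]
    rw [integral_sub (hIntg ν) (hIntg _), conv_eq ν hν hT, conv_eq _ gauss_id_int hT]
    have hI : ∀ (m : Measure ℝ) [IsProbabilityMeasure m] (_ : Integrable (fun x : ℝ => x) m),
        IntervalIntegrable (fun ζ => ∫ x, (1 - ζ / T) * ((t - x) * Real.sinc (ζ * (t - x))) ∂m) volume 0 T := by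
      intro m _ hm
      have := (conv_int m hm hT t).integral_prod_left
      simp only [Function.uncurry] at this
      rw [intervalIntegrable_iff]
      exact this
    rw [add_sub_add_left_eq_sub, ← mul_sub, ← intervalIntegral.integral_sub (hI ν hν) (hI _ gauss_id_int),
      abs_mul, abs_of_pos (by positivity)]
    gcongr
    refine intervalIntegral.norm_integral_le_of_norm_le (f := fun ζ => (∫ x, (1 - ζ / T) * ((t - x) * Real.sinc (ζ * (t - x))) ∂ν) -
      ∫ x, (1 - ζ / T) * ((t - x) * Real.sinc (ζ * (t - x))) ∂(gaussianReal 0 1)) hT.le ?_ hgi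
    refine Eventually.of_forall fun ζ hζ => ?_
    rw [integral_const_mul, integral_const_mul, ← mul_sub, norm_mul, Real.norm_eq_abs, Real.norm_eq_abs]
    have hd := H_diff ν (gaussianReal 0 1) ζ t (g ζ) hζ.1 (hg ζ hζ.1 hζ.2)
    have a1 : ζ / T ≤ 1 := by rw [div_le_iff₀ hT]; linarith [hζ.2]
    have a2 : 0 ≤ ζ / T := by have := hζ.1; positivity
    have b1 : |1 - ζ / T| ≤ 1 := by rw [abs_le]; constructor <;> linarith
    calc _ ≤ 1 * g ζ := by gcongr
      _ = _ := one_mul _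


theorem cexp_bound (α : ℝ) (β : ℂ) (b : ℝ) (hb : ‖β‖ ≤ b) :
    ‖Complex.exp (Complex.I * α + β) - 1‖ ≤ |α| * (Real.exp b + 1) / 2 + (Real.exp b - 1) := by
  have e : Complex.exp (Complex.I * α + β) - 1 =
      (Complex.exp (Complex.I * α) - 1) * (Complex.exp β + 1) / 2 +
      (Complex.exp (Complex.I * α) + 1) * (Complex.exp β - 1) / 2 := by
    rw [Complex.exp_add]; ring
  have h1 : ‖Complex.exp (Complex.I * α) - 1‖ ≤ |α| := by
    simpa using Real.norm_exp_I_mul_ofReal_sub_one_le (x := α)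
  have h2 : ‖Complex.exp β‖ ≤ Real.exp b :=
    (Complex.norm_exp_le_exp_norm β).trans (Real.exp_le_exp.mpr hb)
  have h3 : ‖Complex.exp β - 1‖ ≤ Real.exp b - 1 := by
    have := Complex.norm_exp_sub_sum_le_exp_norm_sub_sum β 1
    simp at this
    have h := Real.exp_le_exp.mpr hb
    linarith
  have h4 : ‖Complex.exp (Complex.I * α)‖ = 1 := by rw [mul_comm]; exact Complex.norm_exp_ofReal_mul_I α
  have h5 : ‖Complex.exp β + 1‖ ≤ Real.exp b + 1 := (norm_add_le _ _).trans (by simpa using h2)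
  have h6 : ‖Complex.exp (Complex.I * α) + 1‖ ≤ 2 := (norm_add_le _ _).trans (by rw [h4]; norm_num)
  rw [e]
  refine (norm_add_le _ _).trans ?_
  rw [norm_div, norm_div, norm_mul, norm_mul]
  have h7 : 0 ≤ Real.exp b - 1 := (norm_nonneg _).trans h3
  have h8 : ‖(2:ℂ)‖ = 2 := by norm_num
  rw [h8]
  calc _ ≤ |α| * (Real.exp b + 1) / 2 + 2 * (Real.exp b - 1) / 2 := by gcongr
    _ = _ := by ring

theorem exp_chord {b b' : ℝ} (hb : 0 ≤ b) (hb' : 0 < b') (h : b ≤ b') :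
    Real.exp b - 1 ≤ b / b' * (Real.exp b' - 1) := by
  have hl : b / b' ≤ 1 := by rw [div_le_one hb']; exact h
  have ha : 0 ≤ 1 - b / b' := by linarith
  have hb2 : 0 ≤ b / b' := by positivity
  have hab : (1 - b / b') + b / b' = 1 := by ring
  have := convexOn_exp.2 (Set.mem_univ 0) (Set.mem_univ b') ha hb2 hab
  simp only [smul_eq_mul, mul_zero, zero_add, Real.exp_zero, mul_one] at this
  rw [div_mul_cancel₀ _ hb'.ne'] at this
  linarith

theorem int_sq_gauss {a T : ℝ} (ha : 0 < a) (hT : 0 < T) :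
    ∫ s in (0:ℝ)..T, s ^ 2 * Real.exp (-a * s ^ 2) ≤ Real.sqrt (Real.pi / a) / (4 * a) := by
  have hd : ∀ s ∈ Set.uIcc 0 T, HasDerivAt (fun s : ℝ => s * Real.exp (-a * s ^ 2))
      (Real.exp (-a * s ^ 2) - 2 * a * (s ^ 2 * Real.exp (-a * s ^ 2))) s := by
    intro s _
    have h1 : HasDerivAt (fun s : ℝ => -a * s ^ 2) (-a * (2 * s)) s := by
      simpa using (hasDerivAt_pow 2 s).const_mul (-a)
    refine ((hasDerivAt_id s).mul h1.exp).congr_deriv ?_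
    simp; ring
  have hf := intervalIntegral.integral_eq_sub_of_hasDerivAt hd (by apply Continuous.intervalIntegrable; fun_prop)
  rw [intervalIntegral.integral_sub (by apply Continuous.intervalIntegrable; fun_prop)
    (by apply Continuous.intervalIntegrable; fun_prop), intervalIntegral.integral_const_mul] at hf
  have hg : ∫ s in (0:ℝ)..T, Real.exp (-a * s ^ 2) ≤ Real.sqrt (Real.pi / a) / 2 := by
    rw [← integral_gaussian_Ioi, intervalIntegral.integral_of_le hT.le]
    refine setIntegral_mono_set (integrable_exp_neg_mul_sq ha).integrableOn
      (Eventually.of_forall fun s => (Real.exp_pos _).le) ?_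
    exact (Set.Ioc_subset_Ioi_self : Set.Ioc 0 T ⊆ Set.Ioi 0).eventuallyLE
  have hp : 0 ≤ T * Real.exp (-a * T ^ 2) := by positivity
  simp only [zero_mul, sub_zero] at hf
  rw [le_div_iff₀ (by positivity)]
  linarith

theorem int_B {T : ℝ} : ∫ s in (0:ℝ)..T, s * (Real.exp (-(1/8) * s ^ 2) - Real.exp (-(1/2) * s ^ 2)) ≤ 3 := by
  have hd : ∀ s ∈ Set.uIcc 0 T, HasDerivAt (fun s : ℝ => Real.exp (-(1/2) * s ^ 2) - 4 * Real.exp (-(1/8) * s ^ 2))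
      (s * (Real.exp (-(1/8) * s ^ 2) - Real.exp (-(1/2) * s ^ 2))) s := by
    intro s _
    have h1 : ∀ a : ℝ, HasDerivAt (fun s : ℝ => -a * s ^ 2) (-a * (2 * s)) s := fun a => by
      simpa using (hasDerivAt_pow 2 s).const_mul (-a)
    refine ((h1 (1/2)).exp.sub ((h1 (1/8)).exp.const_mul 4)).congr_deriv ?_
    ring
  rw [intervalIntegral.integral_eq_sub_of_hasDerivAt hd (by apply Continuous.intervalIntegrable; fun_prop)]
  have h1 : Real.exp (-(1/2) * T ^ 2) ≤ Real.exp (-(1/8) * T ^ 2) := by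
    apply Real.exp_le_exp.mpr
    nlinarith [sq_nonneg T]
  have h2 := Real.exp_pos (-(1/8) * T ^ 2)
  have e0 : Real.exp (-(1/2) * (0:ℝ) ^ 2) = 1 := by simp
  have e1 : Real.exp (-(1/8) * (0:ℝ) ^ 2) = 1 := by simp
  rw [e0, e1]
  linarith

/-- majorant -/
def gg (q B s : ℝ) : ℝ := q / 12 * (s ^ 2 * Real.exp (-(1/8) * s ^ 2)) + q / 12 * (s ^ 2 * Real.exp (-(1/2) * s ^ 2)) +
  160 / 3 * B * (s * (Real.exp (-(1/8) * s ^ 2) - Real.exp (-(1/2) * s ^ 2)))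

theorem gg_ii (q B T : ℝ) : IntervalIntegrable (gg q B) volume 0 T := by
  apply Continuous.intervalIntegrable; unfold gg; fun_prop

theorem gg_int {q B T : ℝ} (hq : 0 ≤ q) (hB : 0 ≤ B) (hT : 0 < T) :
    ∫ s in (0:ℝ)..T, gg q B s ≤ q / 12 * (9 / 2 * Real.sqrt (2 * Real.pi)) + 160 * B := by
  have hpi := Real.pi_pos
  unfold gg
  rw [intervalIntegral.integral_add (by apply Continuous.intervalIntegrable; fun_prop) (by apply Continuous.intervalIntegrable; fun_prop),
    intervalIntegral.integral_add (by apply Continuous.intervalIntegrable; fun_prop) (by apply Continuous.intervalIntegrable; fun_prop),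
    intervalIntegral.integral_const_mul, intervalIntegral.integral_const_mul, intervalIntegral.integral_const_mul]
  have h1 := int_sq_gauss (a := 1/8) (by norm_num) hT
  have h2 := int_sq_gauss (a := 1/2) (by norm_num) hT
  have h3 := int_B (T := T)
  have e1 : Real.sqrt (Real.pi / (1/8)) = 2 * Real.sqrt (2 * Real.pi) := by
    rw [show Real.pi / (1/8) = 2 ^ 2 * (2 * Real.pi) by ring, Real.sqrt_mul (by norm_num), Real.sqrt_sq (by norm_num)]
  have e2 : Real.sqrt (Real.pi / (1/2)) = Real.sqrt (2 * Real.pi) := by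
    congr 1; ring
  rw [e1] at h1
  rw [e2] at h2
  calc _ ≤ q / 12 * (2 * Real.sqrt (2 * Real.pi) / (4 * (1/8))) + q / 12 * (Real.sqrt (2 * Real.pi) / (4 * (1/2))) + 160 / 3 * B * 3 := by
        gcongr
    _ = _ := by ring

theorem point_bound {q B s α : ℝ} {β : ℂ} (hs : 0 < s) (hB : 0 ≤ B) (hq : 0 ≤ q) (hα : |α| ≤ q * s ^ 3 / 6)
    (hβ : ‖β‖ ≤ 20 * B * s ^ 4) (hBs : 20 * B * s ^ 2 ≤ 3 / 8) :
    ‖Complex.exp (-(s^2/2 : ℝ)) * Complex.exp (Complex.I * α + β) - Complex.exp (-(s^2/2 : ℝ))‖ ≤ s * gg q B s := by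
  have h1 := cexp_bound α β _ hβ
  set b := 20 * B * s ^ 4 with hb
  have hb0 : 0 ≤ b := by positivity
  have hbb : b ≤ 3 / 8 * s ^ 2 := by
    rw [hb]; calc _ = (20 * B * s ^ 2) * s ^ 2 := by ring
      _ ≤ _ := by gcongr
  have h2 := exp_chord hb0 (b' := 3/8 * s ^ 2) (by positivity) hbb
  have h3 : b / (3/8 * s ^ 2) = 160 / 3 * B * s ^ 2 := by rw [hb]; field_simp; ring
  rw [h3] at h2
  have h4 : Real.exp b ≤ Real.exp (3/8 * s ^ 2) := Real.exp_le_exp.mpr hbb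
  have e0 : Complex.exp (-(s^2/2 : ℝ)) * Complex.exp (Complex.I * α + β) - Complex.exp (-(s^2/2 : ℝ)) =
      Complex.exp (-(s^2/2 : ℝ)) * (Complex.exp (Complex.I * α + β) - 1) := by ring
  have e1 : ‖Complex.exp (-(s^2/2 : ℝ))‖ = Real.exp (-(1/2) * s ^ 2) := by
    rw [← Complex.ofReal_neg, ← Complex.ofReal_exp, Complex.norm_real, Real.norm_eq_abs, abs_of_pos (Real.exp_pos _)]
    congr 1; ring
  have e2 : Real.exp (-(1/8) * s ^ 2) = Real.exp (-(1/2) * s ^ 2) * Real.exp (3/8 * s ^ 2) := by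
    rw [← Real.exp_add]; congr 1; ring
  rw [e0, norm_mul, e1]
  unfold gg
  rw [e2]
  set E := Real.exp (-(1/2) * s ^ 2)
  have hE : 0 < E := Real.exp_pos _
  set F := Real.exp (3/8 * s ^ 2)
  calc E * _ ≤ E * ((q * s ^ 3 / 6) * (F + 1) / 2 + 160 / 3 * B * s ^ 2 * (F - 1)) := by
        gcongr
        refine h1.trans ?_
        have : |α| * (Real.exp b + 1) / 2 ≤ (q * s ^ 3 / 6) * (F + 1) / 2 := by gcongr
        linarith
    _ = _ := by ring

theorem num_pi : 2.50662 < Real.sqrt (2 * Real.pi) ∧ Real.sqrt (2 * Real.pi) < 2.50663 := by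
  have h1 := Real.pi_gt_d6
  have h2 := Real.pi_lt_d6
  constructor
  · apply Real.lt_sqrt_of_sq_lt; norm_num at *; linarith
  · rw [Real.sqrt_lt' (by norm_num)]; norm_num at *; linarith

/-- constant in smoothing -/
def cc : ℝ := 24 / (Real.pi * Real.sqrt (2 * Real.pi))

theorem cc_pos : 0 < cc := by unfold cc; have := Real.pi_pos; positivity

theorem cc_lt : cc < 16.57 * (1 / (2 * Real.exp 1)) := by
  have h1 := Real.pi_gt_d6
  obtain ⟨h2, _⟩ := num_pi
  have h3 := Real.exp_one_lt_d9
  have he := Real.exp_pos 1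
  unfold cc
  rw [mul_one_div, div_lt_div_iff₀ (by positivity) (by positivity)]
  have : (3.141592:ℝ) * 2.50662 ≤ Real.pi * Real.sqrt (2 * Real.pi) := by gcongr
  norm_num at *
  linarith

theorem cc_sq : 20 * cc ^ 2 ≤ 3 / 8 * 22.47 ^ 2 := by
  have h1 := Real.pi_gt_d6
  obtain ⟨h2, _⟩ := num_pi
  have h : cc ≤ 3.0478 := by
    unfold cc
    rw [div_le_iff₀ (by positivity)]
    have : (3.141592:ℝ) * 2.50662 ≤ Real.pi * Real.sqrt (2 * Real.pi) := by gcongr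
    norm_num at *
    linarith
  have := cc_pos
  calc 20 * cc ^ 2 ≤ 20 * 3.0478 ^ 2 := by gcongr
    _ ≤ _ := by norm_num

theorem be_from_char {Ω : Type*} [MeasurableSpace Ω] (μ : Measure Ω) [IsProbabilityMeasure μ]
    (W : Ω → ℝ) (hWm : Measurable W) (hWi : Integrable W μ) (q B l : ℝ) (hq : 0 ≤ q) (hB : 0 ≤ B) (hl : 0 < l)
    (hchar : ∀ s : ℝ, |s| * l < 1 / (2 * Real.exp 1) → ∃ α : ℝ, ∃ β : ℂ, ‖β‖ ≤ 20 * B * s ^ 4 ∧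
      |α| = q * |s| ^ 3 / 6 ∧ ∫ ω, Complex.exp (Complex.I * s * W ω) ∂μ =
        Complex.exp (-(s^2/2 : ℝ)) * Complex.exp (Complex.I * α + β)) :
    dKolNormal μ W ≤ 0.607148 * q + 116.84 * B + max (16.57 * l) (22.47 * Real.sqrt B) := by
  set m := max (16.57 * l) (22.47 * Real.sqrt B) with hm
  have hm1 : 16.57 * l ≤ m := le_max_left _ _
  have hm2 : 22.47 * Real.sqrt B ≤ m := le_max_right _ _
  have hmp : 0 < m := lt_of_lt_of_le (by positivity) hm1
  have hcc := cc_pos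
  have hT : 0 < cc / m := by positivity
  have hpi := Real.pi_pos
  haveI : IsProbabilityMeasure (μ.map W) := Measure.isProbabilityMeasure_map hWm.aemeasurable
  have hν : Integrable (fun x : ℝ => x) (μ.map W) :=
    (integrable_map_measure (by fun_prop) hWm.aemeasurable).mpr hWi
  have hg : ∀ s, 0 < s → s ≤ cc / m →
      ‖charFun (μ.map W) s - charFun (gaussianReal 0 1) s‖ ≤ s * gg q B s := by
    intro s hs hsT
    have hsm : s * m ≤ cc := by rwa [le_div_iff₀ hmp] at hsT
    have h1 : |s| * l < 1 / (2 * Real.exp 1) := by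
      rw [abs_of_pos hs]
      have h2 := cc_lt
      have : s * (16.57 * l) ≤ s * m := by gcongr
      norm_num at *
      linarith
    obtain ⟨α, β, hβ, hα, he⟩ := hchar s h1
    have h2 : charFun (μ.map W) s = Complex.exp (-(s^2/2 : ℝ)) * Complex.exp (Complex.I * α + β) := by
      rw [← he, charFun_apply_real, integral_map hWm.aemeasurable (by fun_prop)]
      congr 1; ext ω; congr 1; ring
    have h3 : charFun (gaussianReal 0 1) s = Complex.exp (-(s^2/2 : ℝ)) := by
      rw [charFun_gaussianReal]; congr 1; push_cast; ring
    rw [h2, h3]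
    refine point_bound hs hB hq (by rw [hα, abs_of_pos hs]) hβ ?_
    have h4 : (22.47 * Real.sqrt B * s) ^ 2 ≤ cc ^ 2 := by
      gcongr
      calc _ ≤ m * s := by gcongr
        _ ≤ _ := by linarith
    rw [mul_pow, mul_pow, Real.sq_sqrt hB] at h4
    have h5 := cc_sq
    norm_num at h4 h5 ⊢
    linarith
  unfold dKolNormal
  refine ciSup_le fun t => ?_
  have h := esseen (μ.map W) hν hT (gg q B) (gg_ii q B _) hg t
  have e1 : (μ.map W).real (Set.Iic t) = (μ {ω | W ω ≤ t}).toReal := by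
    rw [measureReal_def, Measure.map_apply hWm measurableSet_Iic]; rfl
  have e2 : (gaussianReal 0 1).real (Set.Iic t) = (gaussianReal 0 1 (Set.Iic t)).toReal := rfl
  rw [e1, e2] at h
  have e3 : 24 * (1 / Real.sqrt (2 * Real.pi)) / (Real.pi * (cc / m)) = m := by
    have : Real.sqrt (2 * Real.pi) ≠ 0 := by positivity
    unfold cc
    field_simp
  rw [e3] at h
  refine h.trans ?_
  have hi := gg_int hq hB hT
  obtain ⟨_, hsq⟩ := num_pi
  have hp6 := Real.pi_gt_d6
  have hip : 1 / Real.pi ≤ 1 / 3.141592 := by gcongr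
  have : 2 * (1 / Real.pi * ∫ s in (0:ℝ)..(cc / m), gg q B s) ≤ 2 * (1 / 3.141592 * (q / 12 * (9 / 2 * 2.50663) + 160 * B)) := by
    have h0 : (0:ℝ) ≤ q / 12 * (9 / 2 * Real.sqrt (2 * Real.pi)) + 160 * B := by positivity
    calc _ ≤ 2 * (1 / Real.pi * (q / 12 * (9 / 2 * Real.sqrt (2 * Real.pi)) + 160 * B)) := by gcongr
      _ ≤ 2 * (1 / 3.141592 * (q / 12 * (9 / 2 * Real.sqrt (2 * Real.pi)) + 160 * B)) := by gcongr
      _ ≤ _ := by gcongr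
  have h9 : (2:ℝ) * (1 / 3.141592 * (q / 12 * (9 / 2 * 2.50663) + 160 * B)) ≤ 0.607148 * q + 116.84 * B := by
    norm_num
    linarith
  linarith

/-- Theorem 2.4 of the paper: refined Berry–Esseen bound for bounded random variables with a
dependency graph, involving the third centered moment of `S`. -/
theorem berry_esseen_dependency_bounded_third_cumulant
    {Ω V : Type*} [MeasurableSpace Ω] [Fintype V] [Nonempty V]
    (μ : Measure Ω) [IsProbabilityMeasure μ]
    (Y : V → Ω → ℝ) (hYmeas : ∀ k, Measurable (Y k))
    (G : SimpleGraph V) [DecidableRel G.Adj]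
    (hG : IsDependencyGraph μ G Y)
    (D : ℕ) (hD : ∀ k, G.degree k ≤ D)
    (c : V → ℝ)
    (L : ℝ) (hL : 0 < L)
    (hbdd : ∀ k, ∀ᵐ ω ∂μ, |Y k ω - c k| ≤ L)
    (S : Ω → ℝ) (hS : S = fun ω => ∑ k, Y k ω)
    (v : ℝ) (hv : v = Real.sqrt (variance S μ)) (hvpos : 0 < v)
    (W : Ω → ℝ) (hW : W = fun ω => (S ω - ∫ ω', S ω' ∂μ) / v)
    (ρ : ℝ) (hρ : ρ = |∫ ω, (S ω - ∫ ω', S ω' ∂μ) ^ 3 ∂μ|)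
    (A₄ : ℝ) (hA₄ : A₄ = ∑ k, ∫ ω, |Y k ω - c k| ^ 4 ∂μ) :
    dKolNormal μ W ≤
      0.607148 * ρ / v ^ 3 + 116.84 * (D + 1 : ℝ) ^ 3 * A₄ / v ^ 4 +
        max (16.57 * L * (D + 1 : ℝ) / v)
          (22.47 * Real.sqrt ((D + 1 : ℝ) ^ 3 * A₄ / v ^ 4) + 1.596 * ρ / v ^ 3) := by
  have hρ0 : 0 ≤ ρ := by rw [hρ]; positivity
  have hA0 : 0 ≤ A₄ := by
    rw [hA₄]
    exact Finset.sum_nonneg fun k _ => integral_nonneg fun ω => by positivity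
  have hSm : Measurable S := by rw [hS]; exact Finset.measurable_sum _ fun k _ => hYmeas k
  have hYi : ∀ k, Integrable (Y k) μ := by
    intro k
    refine Integrable.of_bound (hYmeas k).aestronglyMeasurable (L + |c k|) ?_
    filter_upwards [hbdd k] with ω h
    rw [Real.norm_eq_abs]
    have h2 := abs_add_le (Y k ω - c k) (c k)
    rw [sub_add_cancel] at h2
    linarith
  have hSi : Integrable S μ := by rw [hS]; exact integrable_finset_sum _ fun k _ => hYi k
  have hWm : Measurable W := by rw [hW]; exact (hSm.sub_const _).div_const _
  have hWi : Integrable W μ := by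
    rw [hW]; exact (hSi.sub (integrable_const _)).div_const _
  have key := be_from_char μ W hWm hWi (ρ / v ^ 3) ((D + 1 : ℝ) ^ 3 * A₄ / v ^ 4) (L * (D + 1) / v)
    (by positivity) (by positivity) (by positivity) (by
      intro s hs
      obtain ⟨β, hβ, he⟩ := char_form μ Y hYmeas G hG D hD c L hL hbdd S hS v hv hvpos W hW A₄ hA₄ s hs
      refine ⟨_, β, hβ, ?_, he⟩
      rw [abs_neg, abs_div, abs_mul, ← hρ, abs_pow, abs_of_pos (by positivity : 0 < 6 * v ^ 3)]
      field_simp)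
  refine key.trans ?_
  have e1 : 0.607148 * ρ / v ^ 3 = 0.607148 * (ρ / v ^ 3) := by ring
  have e2 : 116.84 * (D + 1 : ℝ) ^ 3 * A₄ / v ^ 4 = 116.84 * ((D + 1 : ℝ) ^ 3 * A₄ / v ^ 4) := by ring
  have e3 : 16.57 * L * (D + 1 : ℝ) / v = 16.57 * (L * (D + 1 : ℝ) / v) := by ring
  rw [e1, e2, e3]
  have h1 : 0 ≤ 1.596 * ρ / v ^ 3 := by positivity
  have h2 := max_le_max (le_refl (16.57 * (L * (D + 1 : ℝ) / v)))
    (le_add_of_nonneg_right h1 : 22.47 * Real.sqrt ((D + 1 : ℝ) ^ 3 * A₄ / v ^ 4) ≤ _)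
  linarith
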